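/- arXiv:2202.05250 — 6 statements merged into one kernel-verified Lean document; each statement's English description precedes it below -/
import Mathlib

section
/- Let m ≥ 1, n ≥ 1, real data x_{ji} for j ∈ {1,…,m}, i ∈ {1,…,n}, and set f_j(θ) = (1/(2n))·Σ_{i=1}^n (x_{ji} − θ)² and x̄_j = (1/n)·Σ_{i=1}^n x_{ji}. Fix λ ≥ 0 and suppose (θ̂_1,…,θ̂_m,θ̂) ∈ ℝ^{m+1} minimizes the function (θ_1,…,θ_m,θ) ↦ Σ_{j=1}^m [ f_j(θ_j) + λ|θ_j − θ| ]. Then θ̂ minimizes the function θ ↦ Σ_{j=1}^m ρ_λ(θ − x̄_j), and for every j ∈ {1,…,m}, θ̂_j = θ̂ + sgn(x̄_j − θ̂)·(|x̄_j − θ̂| − λ)_+ = x̄_j − min{λ, |x̄_j − θ̂|}·sgn(x̄_j − θ̂), where (x)_+ = max{x, 0} and sgn is the sign function. -/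
/-- The Huber loss with parameter `l`. -/
noncomputable def huber (l x : ℝ) : ℝ := if |x| ≤ l then x ^ 2 / 2 else l * (|x| - l / 2)

/-- Soft thresholding of `a` toward `c`. -/
noncomputable def soft (l a c : ℝ) : ℝ := c + Real.sign (a - c) * max (|a - c| - l) 0

lemma soft_cases (l a c : ℝ) (hl : 0 ≤ l) :
    (|a - c| ≤ l ∧ soft l a c = c) ∨ (l < a - c ∧ soft l a c = a - l) ∨
      (a - c < -l ∧ soft l a c = a + l) := by
  unfold soft
  rcases le_or_gt (|a - c|) l with h | h
  · left
    refine ⟨h, ?_⟩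
    rw [max_eq_right (by linarith)]; ring
  · right
    rw [max_eq_left (by linarith)]
    rcases lt_abs.mp h with h1 | h1
    · left
      refine ⟨h1, ?_⟩
      rw [Real.sign_of_pos (by linarith), abs_of_pos (by linarith)]; ring
    · right
      refine ⟨by linarith, ?_⟩
      rw [Real.sign_of_neg (by linarith), abs_of_neg (by linarith)]; ring

lemma soft_eq (l a c : ℝ) (hl : 0 ≤ l) :
    soft l a c = a - min l |a - c| * Real.sign (a - c) := by
  rcases soft_cases l a c hl with ⟨h, e⟩ | ⟨h, e⟩ | ⟨h, e⟩
  · rw [e, min_eq_right h]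
    rcases lt_trichotomy (a - c) 0 with h1 | h1 | h1
    · rw [Real.sign_of_neg h1, abs_of_neg h1]; ring
    · rw [h1]; simp; linarith
    · rw [Real.sign_of_pos h1, abs_of_pos h1]; ring
  · rw [e, Real.sign_of_pos (by linarith), abs_of_pos (by linarith), min_eq_left h.le]; ring
  · rw [e, Real.sign_of_neg (by linarith), abs_of_neg (by linarith), min_eq_left (by linarith)]
    ring

lemma huber_le (l a c u : ℝ) (hl : 0 ≤ l) :
    huber l (c - a) + (u - soft l a c) ^ 2 / 2 ≤ (a - u) ^ 2 / 2 + l * |u - c| := by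
  unfold huber
  rw [abs_sub_comm c a]
  rcases soft_cases l a c hl with ⟨h, e⟩ | ⟨h, e⟩ | ⟨h, e⟩
  · rw [if_pos h, e]
    have h1 : (a - c) * (u - c) ≤ l * |u - c| :=
      (le_abs_self _).trans (by rw [abs_mul]; gcongr)
    nlinarith
  · rw [abs_of_pos (by linarith), if_neg (by linarith), e]
    have := mul_le_mul_of_nonneg_left (le_abs_self (u - c)) hl
    nlinarith
  · rw [abs_of_neg (by linarith), if_neg (by linarith), e]
    have := mul_le_mul_of_nonneg_left (neg_abs_le (u - c)) hl
    nlinarith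

lemma huber_soft (l a c : ℝ) (hl : 0 ≤ l) :
    (a - soft l a c) ^ 2 / 2 + l * |soft l a c - c| = huber l (c - a) := by
  unfold huber
  rw [abs_sub_comm c a]
  rcases soft_cases l a c hl with ⟨h, e⟩ | ⟨h, e⟩ | ⟨h, e⟩
  · rw [if_pos h, e]; simp; ring
  · rw [abs_of_pos (show 0 < a - c by linarith), if_neg (by linarith), e,
      abs_of_pos (by linarith)]
    ring
  · rw [abs_of_neg (show a - c < 0 by linarith), if_neg (by linarith), e,
      abs_of_neg (by linarith)]
    ring

lemma quad_split (n : ℕ) (hn : 1 ≤ n) (y : Fin n → ℝ) (b u : ℝ)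
    (hb : b = (1 / (n : ℝ)) * ∑ i, y i) :
    (1 / (2 * (n : ℝ))) * ∑ i, (y i - u) ^ 2 =
      (b - u) ^ 2 / 2 + ((1 / (2 * (n : ℝ))) * ∑ i, (y i) ^ 2 - b ^ 2 / 2) := by
  have hn0 : (n : ℝ) ≠ 0 := by positivity
  have h : ∑ i, (y i - u) ^ 2 = ∑ i, (y i) ^ 2 - 2 * u * ∑ i, y i + n * u ^ 2 := by
    simp only [sub_sq, Finset.sum_add_distrib, Finset.sum_sub_distrib, Finset.mul_sum]
    simp
    exact Finset.sum_congr rfl fun i _ => by ring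
  have h2 : ∑ i, y i = n * b := by rw [hb]; field_simp
  rw [h, h2]
  field_simp
  ring

/-- Any minimizer of the vanilla ARMUL objective for multi-task Gaussian mean estimation:
the global coordinator is a Huber estimator of the sample means, and the individual
estimates are obtained from the sample means by soft thresholding toward the coordinator. -/
theorem stmt_1 (m n : ℕ) (hm : 1 ≤ m) (hn : 1 ≤ n) (x : Fin m → Fin n → ℝ)
    (lam : ℝ) (hlam : 0 ≤ lam)
    (xbar : Fin m → ℝ) (hxbar : ∀ j, xbar j = (1 / (n : ℝ)) * ∑ i, x j i)
    (θhat : Fin m → ℝ) (θc : ℝ)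
    (hmin : ∀ (θ : Fin m → ℝ) (c : ℝ),
      ∑ j, ((1 / (2 * (n : ℝ))) * ∑ i, (x j i - θhat j) ^ 2 + lam * |θhat j - θc|) ≤
      ∑ j, ((1 / (2 * (n : ℝ))) * ∑ i, (x j i - θ j) ^ 2 + lam * |θ j - c|)) :
    (∀ t : ℝ, ∑ j, huber lam (θc - xbar j) ≤ ∑ j, huber lam (t - xbar j)) ∧
    (∀ j, θhat j = θc + Real.sign (xbar j - θc) * max (|xbar j - θc| - lam) 0 ∧
      θhat j = xbar j - min lam |xbar j - θc| * Real.sign (xbar j - θc)) := by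
  have key : ∀ t : ℝ, ∑ j, huber lam (θc - xbar j) +
      ∑ j, (θhat j - soft lam (xbar j) θc) ^ 2 / 2 ≤ ∑ j, huber lam (t - xbar j) := by
    intro t
    have h := hmin (fun j => soft lam (xbar j) t) t
    simp only [fun j u => quad_split n hn (x j) (xbar j) u (hxbar j), add_right_comm _ _ (lam * _)]
      at h
    simp only [huber_soft _ _ _ hlam] at h
    simp only [Finset.sum_add_distrib] at h
    have h2 := Finset.sum_le_sum fun j (_ : j ∈ Finset.univ) =>
      huber_le lam (xbar j) θc (θhat j) hlam
    simp only [Finset.sum_add_distrib] at h2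
    linarith
  have hnn : ∀ j ∈ Finset.univ, 0 ≤ (θhat j - soft lam (xbar j) θc) ^ 2 / 2 :=
    fun j _ => by positivity
  refine ⟨fun t => by linarith [key t, Finset.sum_nonneg hnn], fun j => ?_⟩
  have h0 : ∑ j, (θhat j - soft lam (xbar j) θc) ^ 2 / 2 = 0 :=
    le_antisymm (by linarith [key θc]) (Finset.sum_nonneg hnn)
  have hj := (Finset.sum_eq_zero_iff_of_nonneg hnn).mp h0 j (Finset.mem_univ j)
  have e : θhat j = soft lam (xbar j) θc := by
    have : (θhat j - soft lam (xbar j) θc) ^ 2 = 0 := by linarith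
    exact sub_eq_zero.mp (pow_eq_zero_iff (two_ne_zero) |>.mp this)
  exact ⟨e, e.trans (soft_eq _ _ _ hlam)⟩
end

section
/- Let m ≥ 1, λ > 0, x_1,…,x_m ∈ ℝ, x̄ = (1/m)·Σ_{j=1}^m x_j, and suppose (θ̃_1,…,θ̃_m,θ̃) ∈ ℝ^{m+1} minimizes the function (θ_1,…,θ_m,θ) ↦ Σ_{j=1}^m [ (θ_j − x_j)² + λ(θ_j − θ)² ]. Then θ̃ = x̄ and θ̃_j = x̄ + (x_j − x̄)/(1+λ) for every j. Moreover, setting S = Σ_{j=1}^m (x_j − x̄)², if S > m − 3 and λ = (m−3)/(S − (m−3)), then θ̃_j = x̄ + (1 − (m−3)/S)·(x_j − x̄) for every j, i.e., (θ̃_1,…,θ̃_m) equals the James–Stein estimator shrinking toward the pooled mean. -/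
/-- Ridge-regularized multi-task mean estimation: the coordinator is the pooled mean,
each estimate shrinks linearly toward it, and for a particular data-driven choice of the
ridge parameter the estimates coincide with the James–Stein estimator shrinking toward
the pooled mean. -/
theorem stmt_2 (m : ℕ) (hm : 1 ≤ m) (lam : ℝ) (hlam : 0 < lam) (x : Fin m → ℝ)
    (xbar : ℝ) (hxbar : xbar = (1 / (m : ℝ)) * ∑ j, x j)
    (θt : Fin m → ℝ) (θc : ℝ)
    (hmin : ∀ (θ : Fin m → ℝ) (c : ℝ),
      ∑ j, ((θt j - x j) ^ 2 + lam * (θt j - θc) ^ 2) ≤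
      ∑ j, ((θ j - x j) ^ 2 + lam * (θ j - c) ^ 2)) :
    θc = xbar ∧ (∀ j, θt j = xbar + (x j - xbar) / (1 + lam)) ∧
    (∀ S : ℝ, S = ∑ j, (x j - xbar) ^ 2 → S > (m : ℝ) - 3 →
      lam = ((m : ℝ) - 3) / (S - ((m : ℝ) - 3)) →
      ∀ j, θt j = xbar + (1 - ((m : ℝ) - 3) / S) * (x j - xbar)) := by
  have hm0 : (0 : ℝ) < m := by exact_mod_cast hm
  have hl : 0 < 1 + lam := by linarith
  have hsum : ∑ j, (x j - xbar) = 0 := by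
    rw [Finset.sum_sub_distrib]
    simp only [Finset.sum_const, Finset.card_univ, Fintype.card_fin, nsmul_eq_mul]
    rw [hxbar]
    field_simp
    ring
  have key : ∀ (a : Fin m → ℝ) (c : ℝ), ∑ j, ((a j - x j) ^ 2 + lam * (a j - c) ^ 2) =
      (1 + lam) * ∑ j, (a j - (x j + lam * c) / (1 + lam)) ^ 2
      + lam / (1 + lam) * (∑ j, (x j - xbar) ^ 2) + lam / (1 + lam) * (m * (c - xbar) ^ 2) := by
    intro a c
    have h1 : ∀ j, (a j - x j) ^ 2 + lam * (a j - c) ^ 2 =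
        (1 + lam) * (a j - (x j + lam * c) / (1 + lam)) ^ 2 + lam / (1 + lam) * (x j - xbar) ^ 2
        + lam / (1 + lam) * (c - xbar) ^ 2
        - (2 * lam / (1 + lam) * (c - xbar)) * (x j - xbar) := by
      intro j
      field_simp
      ring
    rw [Finset.sum_congr rfl (fun j _ => h1 j), Finset.sum_sub_distrib, Finset.sum_add_distrib,
      Finset.sum_add_distrib, ← Finset.mul_sum, ← Finset.mul_sum, ← Finset.mul_sum _ _ (2 * lam / (1 + lam) * (c - xbar)), hsum]
    simp only [Finset.sum_const, Finset.card_univ, Fintype.card_fin, nsmul_eq_mul]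
    ring
  have h := hmin (fun j => (x j + lam * xbar) / (1 + lam)) xbar
  rw [key θt θc, key (fun j => (x j + lam * xbar) / (1 + lam)) xbar] at h
  simp only [sub_self, ne_eq, OfNat.ofNat_ne_zero, not_false_eq_true, zero_pow,
    Finset.sum_const_zero, mul_zero, add_zero, zero_add] at h
  have hA : 0 ≤ ∑ j, (θt j - (x j + lam * θc) / (1 + lam)) ^ 2 :=
    Finset.sum_nonneg (fun j _ => sq_nonneg _)
  have hA' := mul_nonneg hl.le hA
  have hB : 0 ≤ lam / (1 + lam) * (m * (θc - xbar) ^ 2) := by positivity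
  have hB0 : lam / (1 + lam) * (m * (θc - xbar) ^ 2) = 0 := by linarith
  have hA0 : (1 + lam) * ∑ j, (θt j - (x j + lam * θc) / (1 + lam)) ^ 2 = 0 := by linarith
  have hc : θc = xbar := by
    have h2 : lam / (1 + lam) ≠ 0 := by positivity
    have h3 := (mul_eq_zero.mp ((mul_eq_zero.mp hB0).resolve_left h2)).resolve_left hm0.ne'
    exact sub_eq_zero.mp (pow_eq_zero_iff (two_ne_zero) |>.mp h3)
  have ht : ∀ j, θt j = xbar + (x j - xbar) / (1 + lam) := by
    intro j
    have h2 := (mul_eq_zero.mp hA0).resolve_left hl.ne'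
    rw [Finset.sum_eq_zero_iff_of_nonneg (fun j _ => sq_nonneg _)] at h2
    have h3 := sub_eq_zero.mp (pow_eq_zero_iff (two_ne_zero) |>.mp (h2 j (Finset.mem_univ j)))
    rw [h3, hc]
    field_simp
    ring
  refine ⟨hc, ht, ?_⟩
  intro S _ hS hlS j
  have hd : 0 < S - ((m : ℝ) - 3) := by linarith
  have hm3 : 0 < (m : ℝ) - 3 := by
    rw [hlS] at hlam
    exact (div_pos_iff_of_pos_right hd).mp hlam
  have hS0 : 0 < S := by linarith
  have hs : 1 + lam = S / (S - ((m : ℝ) - 3)) := by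
    rw [hlS]
    field_simp
    ring
  rw [ht j, hs]
  field_simp
end

section
/- There exists a universal constant C > 0 such that the following holds. Let m ≥ 2, n ≥ 1, ε ∈ [0, 1/2), δ ≥ 0, and θ* = (θ*_1,…,θ*_m) ∈ ℝ^m for which there exists S ⊆ {1,…,m} with |S^c| ≤ ε·m and min_{θ∈ℝ} max_{j∈S} |θ*_j − θ| ≤ δ. Let {x_{ji} : j ∈ [m], i ∈ [n]} be independent real random variables with x_{ji} distributed as the Gaussian N(θ*_j, 1). Fix t ≥ 1, c ∈ [ε, 1/2), and set λ = (5/(1−2c))·√(2(log m + t)/n). Define f_j(θ) = (1/(2n))·Σ_{i=1}^n (x_{ji} − θ)². Then with probability at least 1 − e^{−t}, every minimizer (θ̂_1,…,θ̂_m,θ̂) of (θ_1,…,θ_m,θ) ↦ Σ_{j=1}^m [ f_j(θ_j) + λ|θ_j − θ| ] satisfies max_{j∈S} |θ̂_j − θ*_j| < (C/(1−2c)²)·( √(t/(mn)) + min{ δ, √((log m + t)/n) } + ε·√((log m + t)/n) ) and max_{j∈S^c} |θ̂_j − θ*_j| < (C/(1−2c)²)·√((log m + t)/n). -/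
open MeasureTheory

namespace Armul

open ProbabilityTheory

lemma prox {l x y z : ℝ} (hl : 0 ≤ l)
    (h : ∀ u, (x - y) ^ 2 / 2 + l * |y - z| ≤ (x - u) ^ 2 / 2 + l * |u - z|) :
    x - y = max (-l) (min l (x - z)) := by
  rcases le_or_gt (x - z) l with h1 | h1
  · rcases le_or_gt (-l) (x - z) with h2 | h2
    · rw [min_eq_right h1, max_eq_right h2]
      have h3 := h z
      simp only [sub_self, abs_zero, mul_zero, add_zero] at h3
      have h4 : (x - z) * (y - z) ≤ l * |y - z| := by
        calc (x - z) * (y - z) ≤ |(x - z) * (y - z)| := le_abs_self _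
          _ = |x - z| * |y - z| := abs_mul _ _
          _ ≤ l * |y - z| := by
            gcongr
            exact abs_le.2 ⟨h2, h1⟩
      have h5 : (y - z) ^ 2 ≤ 0 := by nlinarith
      have h6 : y - z = 0 := by
        apply pow_eq_zero_iff (two_ne_zero) |>.1
        exact le_antisymm h5 (sq_nonneg _)
      linarith
    · rw [min_eq_right h1, max_eq_left h2.le]
      have h3 := h (x + l)
      rw [abs_of_nonpos (by linarith : x + l - z ≤ 0)] at h3
      have h4 : l * (-(y - z)) ≤ l * |y - z| := mul_le_mul_of_nonneg_left (neg_le_abs _) hl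
      have h5 : (x - y + l) ^ 2 ≤ 0 := by nlinarith
      have h6 : x - y + l = 0 := by
        apply pow_eq_zero_iff (two_ne_zero) |>.1
        exact le_antisymm h5 (sq_nonneg _)
      linarith
  · rw [min_eq_left h1.le, max_eq_right (by linarith)]
    have h3 := h (x - l)
    rw [abs_of_nonneg (by linarith : 0 ≤ x - l - z)] at h3
    have h4 : l * (y - z) ≤ l * |y - z| := mul_le_mul_of_nonneg_left (le_abs_self _) hl
    have h5 : (x - y - l) ^ 2 ≤ 0 := by nlinarith
    have h6 : x - y - l = 0 := by
      apply pow_eq_zero_iff (two_ne_zero) |>.1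
      exact le_antisymm h5 (sq_nonneg _)
    linarith

/-- first-order conditions. -/
lemma foc {m : ℕ} (hm : 0 < m) {l : ℝ} (hl : 0 ≤ l) (x y K : Fin m → ℝ) (z : ℝ)
    (h : ∀ (θ : Fin m → ℝ) (c : ℝ),
      ∑ j, (K j + (x j - y j) ^ 2 / 2 + l * |y j - z|) ≤
      ∑ j, (K j + (x j - θ j) ^ 2 / 2 + l * |θ j - c|)) :
    (∀ j, x j - y j = max (-l) (min l (x j - z))) ∧ ∑ j, (x j - y j) = 0 := by
  constructor
  · intro k
    apply prox hl
    intro u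
    by_contra hlt
    push Not at hlt
    have h1 := h (Function.update y k u) z
    refine absurd h1 (not_le.2 ?_)
    apply Finset.sum_lt_sum
    · intro i _
      by_cases hik : i = k
      · subst hik; simp only [Function.update_self]; linarith
      · rw [Function.update_of_ne hik]
    · refine ⟨k, Finset.mem_univ _, ?_⟩
      simp only [Function.update_self]; linarith
  · set P := ∑ j, (x j - y j) with hP
    have hm' : (0 : ℝ) < m := by exact_mod_cast hm
    have h1 := h (fun j => y j + P / m) (z + P / m)
    have h2 : ∑ j, (K j + (x j - (y j + P / m)) ^ 2 / 2 + l * |(y j + P / m) - (z + P / m)|)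
        = ∑ j, (K j + (x j - y j) ^ 2 / 2 + l * |y j - z|) - P / m * P + m * (P / m) ^ 2 / 2 := by
      have : ∀ j, (K j + (x j - (y j + P / m)) ^ 2 / 2 + l * |(y j + P / m) - (z + P / m)|)
        = (K j + (x j - y j) ^ 2 / 2 + l * |y j - z|) - P / m * (x j - y j) + (P / m) ^ 2 / 2 := by
        intro j
        rw [add_sub_add_right_eq_sub]; ring
      simp only [this]
      rw [Finset.sum_add_distrib, Finset.sum_sub_distrib, ← Finset.mul_sum, ← hP]
      simp; ring
    rw [h2] at h1
    have h3 : P / m * P - m * (P / m) ^ 2 / 2 = P ^ 2 / (2 * m) := by field_simp; ring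
    have h4 : P ^ 2 / (2 * m) ≤ 0 := by linarith
    have h5 : P ^ 2 ≤ 0 := by
      by_contra hc
      push Not at hc
      have : 0 < P ^ 2 / (2 * m) := by positivity
      linarith
    exact pow_eq_zero_iff (two_ne_zero) |>.1 (le_antisymm h5 (sq_nonneg _))

/-- one-sided localisation of the centre. -/
lemma loc {m : ℕ} {l s ε k : ℝ} (hs : 0 < s) (S : Finset (Fin m)) (hm : 0 < m)
    (hcard : ((Sᶜ : Finset (Fin m)).card : ℝ) ≤ ε * m) (hk : k ≤ 1 - 2 * ε)
    (hk0 : 0 < k) (hk1 : k ≤ 1) (hlk : 7 * s ≤ l * k)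
    (x p : Fin m → ℝ) (z θ0 : ℝ) (hx : ∀ j ∈ S, x j - θ0 ≤ 3 * s)
    (hp : ∀ j, p j = max (-l) (min l (x j - z))) (hsum : ∑ j, p j = 0) :
    z - θ0 < l - 3 * s := by
  by_contra hD
  push Not at hD
  have hm' : (0 : ℝ) < m := by exact_mod_cast hm
  have hl0 : 0 < l := by
    by_contra hc
    push Not at hc
    nlinarith
  have hl : 7 * s ≤ l := by nlinarith
  have h1 : ∑ j ∈ S, p j ≤ S.card * (6 * s - l) := by
    rw [← nsmul_eq_mul]
    apply Finset.sum_le_card_nsmul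
    intro j hj
    rw [hp j]
    apply max_le (by linarith)
    apply (min_le_right _ _).trans
    linarith [hx j hj]
  have h2 : ∑ j ∈ Sᶜ, p j ≤ (Sᶜ : Finset (Fin m)).card * l := by
    rw [← nsmul_eq_mul]
    apply Finset.sum_le_card_nsmul
    intro j hj
    rw [hp j]
    exact max_le (by linarith) (min_le_left _ _)
  have h3 := Finset.sum_add_sum_compl S p
  have h4 : (S.card : ℝ) + (Sᶜ : Finset (Fin m)).card = m := by
    have := Finset.card_add_card_compl S
    rw [Fintype.card_fin] at this
    exact_mod_cast this
  set A : ℝ := (S.card : ℝ)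
  set B : ℝ := ((Sᶜ : Finset (Fin m)).card : ℝ)
  have hB : 0 ≤ B := Nat.cast_nonneg _
  have h5 : 0 ≤ A * (6 * s - l) + B * l := by linarith
  have h6 : A * (6 * s - l) + B * l = 6 * s * m - 6 * s * B - l * (m - 2 * B) := by
    rw [show A = m - B by linarith]; ring
  have h7 : k * m ≤ m - 2 * B := by nlinarith
  have h8 : l * (k * m) ≤ l * (m - 2 * B) := mul_le_mul_of_nonneg_left h7 hl0.le
  have h9 : 7 * s * m ≤ l * k * m := mul_le_mul_of_nonneg_right hlk hm'.le
  have h10 : 0 ≤ s * B := by positivity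
  have h11 : 0 < s * m := by positivity
  nlinarith

lemma det {m : ℕ} {l s ε k δ τ : ℝ} (hs : 0 < s) (hτ : 0 < τ) (S : Finset (Fin m)) (hm : 0 < m)
    (hε : 0 ≤ ε) (hε2 : ε < 1 / 2) (hδ : 0 ≤ δ)
    (hcard : ((Sᶜ : Finset (Fin m)).card : ℝ) ≤ ε * m) (hk : k ≤ 1 - 2 * ε)
    (hk0 : 0 < k) (hk1 : k ≤ 1) (hlk : 7 * s ≤ l * k) (hlk2 : l * k ≤ 7.1 * s)
    (x y θs : Fin m → ℝ) (z θ0 : ℝ) (hθ : ∀ j ∈ S, |θs j - θ0| ≤ δ)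
    (hx : ∀ j, |x j - θs j| ≤ 2 * s) (hW : |∑ j ∈ S, (x j - θs j)| ≤ 2.5 * (τ * m))
    (hp : ∀ j, x j - y j = max (-l) (min l (x j - z))) (hsum : ∑ j, (x j - y j) = 0) :
    (∀ j ∈ S, |y j - θs j| < 20 / k ^ 2 * (τ + min δ s + ε * s)) ∧
    (∀ j ∈ Sᶜ, |y j - θs j| < 20 / k ^ 2 * s) := by
  have hm' : (0 : ℝ) < m := by exact_mod_cast hm
  have hk2 : k ^ 2 ≤ k := by nlinarith
  have hl0 : 0 < l := by
    by_contra hc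
    push Not at hc
    nlinarith
  have hl' : l ≤ 7.1 * s / k ^ 2 := by
    rw [le_div_iff₀ (by positivity)]
    nlinarith
  have hone : 1 ≤ 1 / k ^ 2 := by
    rw [le_div_iff₀ (by positivity)]
    nlinarith
  have hpb : ∀ j, |x j - y j| ≤ l := by
    intro j
    rw [hp j, abs_le]
    exact ⟨le_max_left _ _, max_le (by linarith) (min_le_left _ _)⟩
  have triv : ∀ j, |y j - θs j| < 20 / k ^ 2 * s := by
    intro j
    have h1 : |y j - θs j| ≤ l + 2 * s := by
      have h2 := abs_le.1 (hpb j)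
      have h3 := abs_le.1 (hx j)
      rw [abs_le]; constructor <;> linarith
    have h4 : 7.1 * s / k ^ 2 = 7.1 * (1 / k ^ 2 * s) := by ring
    have h5 : 20 / k ^ 2 * s = 20 * (1 / k ^ 2 * s) := by ring
    have h6 : s ≤ 1 / k ^ 2 * s := by nlinarith
    rw [h5]; rw [h4] at hl'
    linarith
  refine ⟨?_, fun j _ => triv j⟩
  intro j hj
  rcases le_or_gt s δ with hsd | hsd
  · rw [min_eq_right hsd]
    refine (triv j).trans_le ?_
    have : 0 ≤ ε * s := by positivity
    apply mul_le_mul_of_nonneg_left _ (by positivity)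
    linarith
  rw [min_eq_left hsd.le]
  have hx0 : ∀ j ∈ S, |x j - θ0| ≤ 3 * s := by
    intro j hj
    have h2 := abs_le.1 (hx j)
    have h3 := abs_le.1 (hθ j hj)
    rw [abs_le]; constructor <;> linarith
  have hD1 := loc hs S hm hcard hk hk0 hk1 hlk x (fun j => x j - y j) z θ0
    (fun j hj => (abs_le.1 (hx0 j hj)).2) hp hsum
  have hD2 := loc hs S hm hcard hk hk0 hk1 hlk (fun j => - x j) (fun j => -(x j - y j)) (-z) (-θ0)
    (fun j hj => by linarith [(abs_le.1 (hx0 j hj)).1])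
    (fun j => by
      rw [hp j, ← min_neg_neg, ← max_neg_neg, neg_neg]
      rw [show - x j - -z = -(x j - z) by ring]
      rw [max_min_distrib_left, max_eq_right (by linarith : -l ≤ l)])
    (by rw [Finset.sum_neg_distrib, hsum, neg_zero])
  have hyz : ∀ j ∈ S, y j = z := by
    intro j hj
    have h1 := abs_le.1 (hx0 j hj)
    have h2 := hp j
    rw [min_eq_right (by linarith), max_eq_right (by linarith)] at h2
    linarith
  have h3 := Finset.sum_add_sum_compl S (fun j => x j - y j)
  rw [hsum] at h3
  have h4 : (S.card : ℝ) + (Sᶜ : Finset (Fin m)).card = m := by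
    have := Finset.card_add_card_compl S
    rw [Fintype.card_fin] at this
    exact_mod_cast this
  have h5 : ∑ j ∈ S, (x j - y j) = ∑ j ∈ S, (x j - θs j) + ∑ j ∈ S, (θs j - θ0)
      - S.card * (z - θ0) := by
    rw [← nsmul_eq_mul, ← Finset.sum_const, ← Finset.sum_add_distrib, ← Finset.sum_sub_distrib]
    apply Finset.sum_congr rfl
    intro i hi
    rw [hyz i hi]; ring
  have h6 : |∑ j ∈ S, (θs j - θ0)| ≤ S.card * δ := by
    refine (Finset.abs_sum_le_sum_abs _ _).trans ?_
    rw [← nsmul_eq_mul]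
    exact Finset.sum_le_card_nsmul _ _ _ hθ
  have h7 : |∑ j ∈ Sᶜ, (x j - y j)| ≤ (Sᶜ : Finset (Fin m)).card * l := by
    refine (Finset.abs_sum_le_sum_abs _ _).trans ?_
    rw [← nsmul_eq_mul]
    exact Finset.sum_le_card_nsmul _ _ _ (fun j _ => hpb j)
  set A : ℝ := (S.card : ℝ)
  set B : ℝ := ((Sᶜ : Finset (Fin m)).card : ℝ)
  have hA : (m : ℝ) / 2 ≤ A := by nlinarith
  have hBl : B * l ≤ ε * m * l := mul_le_mul_of_nonneg_right hcard hl0.le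
  have h8 : A * |z - θ0| ≤ 2.5 * (τ * m) + A * δ + ε * m * l := by
    have hA0 : 0 ≤ A := by linarith
    rw [← abs_of_nonneg hA0, ← abs_mul, abs_of_nonneg hA0]
    have e : A * (z - θ0) = ∑ j ∈ S, (x j - θs j) + ∑ j ∈ S, (θs j - θ0)
      + ∑ j ∈ Sᶜ, (x j - y j) := by linarith
    rw [e]
    refine (abs_add_three _ _ _).trans ?_
    linarith
  have h9 : |z - θ0| - δ ≤ 5 * τ + 2 * ε * l := by
    by_contra hc
    push Not at hc
    have : 0 ≤ 2 * ε * l := by positivity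
    have h10 : (m : ℝ) / 2 * (5 * τ + 2 * ε * l) < (m : ℝ) / 2 * (|z - θ0| - δ) :=
      mul_lt_mul_of_pos_left hc (by positivity)
    have h11 : (m : ℝ) / 2 * (|z - θ0| - δ) ≤ A * (|z - θ0| - δ) :=
      mul_le_mul_of_nonneg_right hA (by linarith)
    nlinarith
  have h10 : |y j - θs j| ≤ 5 * τ + 2 * δ + 2 * ε * l := by
    rw [hyz j hj]
    have h2 := abs_le.1 (le_refl |z - θ0|)
    have h3 := abs_le.1 (hθ j hj)
    rw [abs_le]; constructor <;> linarith
  have h11 : ε * l ≤ 7.1 * (1 / k ^ 2 * (ε * s)) := by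
    calc ε * l ≤ ε * (7.1 * s / k ^ 2) := mul_le_mul_of_nonneg_left hl' hε
      _ = _ := by ring
  have h12 : τ ≤ 1 / k ^ 2 * τ := le_mul_of_one_le_left hτ.le hone
  have h13 : δ ≤ 1 / k ^ 2 * δ := le_mul_of_one_le_left hδ hone
  have h14 : 0 ≤ 1 / k ^ 2 * (ε * s) := by positivity
  have h15 : 20 / k ^ 2 * (τ + δ + ε * s) = 20 * (1 / k ^ 2 * τ) + 20 * (1 / k ^ 2 * δ)
    + 20 * (1 / k ^ 2 * (ε * s)) := by ring
  rw [h15]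
  linarith

lemma mono_subG {Ω : Type*} [MeasurableSpace Ω] {μ : Measure Ω} {X : Ω → ℝ} {c c' : NNReal}
    (h : HasSubgaussianMGF X c μ) (hc : c ≤ c') : HasSubgaussianMGF X c' μ :=
  ⟨h.integrable_exp_mul, fun t => (h.mgf_le t).trans (by
    apply Real.exp_le_exp.2
    have : (c : ℝ) ≤ c' := by exact_mod_cast hc
    gcongr)⟩

lemma tail {Ω : Type*} [MeasurableSpace Ω] {μ : Measure Ω} [IsProbabilityMeasure μ]
    {X : Ω → ℝ} {c : NNReal}
    (h : HasSubgaussianMGF X c μ) {u K : ℝ} (hu : 0 ≤ u) (hK : u ^ 2 / (2 * c) = K) :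
    μ.real {ω | u ≤ |X ω|} ≤ 2 * Real.exp (-K) := by
  have h1 := h.measure_ge_le hu
  have h2 := h.neg.measure_ge_le hu
  rw [neg_div, hK] at h1 h2
  have h3 : {ω | u ≤ |X ω|} ⊆ {ω | u ≤ X ω} ∪ {ω | u ≤ (-X) ω} := by
    intro ω hω
    simp only [Set.mem_ofPred_eq, Set.mem_union, Pi.neg_apply] at hω ⊢
    exact le_abs.1 hω
  calc _ ≤ μ.real ({ω | u ≤ X ω} ∪ {ω | u ≤ (-X) ω}) := measureReal_mono h3
    _ ≤ _ := measureReal_union_le _ _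
    _ ≤ _ := by linarith

lemma gauss_subG (θ : ℝ) : HasSubgaussianMGF (fun x => x - θ) 1 (gaussianReal θ 1) := by
  have hmap : (gaussianReal θ 1).map (fun x => x - θ) = gaussianReal 0 1 := by
    rw [gaussianReal_map_sub_const, sub_self]
  have hX : AEMeasurable (fun x : ℝ => x - θ) (gaussianReal θ 1) := by fun_prop
  rw [← HasSubgaussianMGF.id_map_iff hX, hmap]
  refine ⟨fun t => integrable_exp_mul_gaussianReal t, fun t => ?_⟩
  rw [mgf_id_gaussianReal]
  simp

lemma inner_subG (n : ℕ) (θ : ℝ) :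
    HasSubgaussianMGF (fun w : Fin n → ℝ => ∑ i, (w i - θ)) n
      (Measure.pi fun _ : Fin n => gaussianReal θ 1) := by
  have h := HasSubgaussianMGF.sum_of_iIndepFun
    (iIndepFun_pi (μ := fun _ : Fin n => gaussianReal θ 1) (X := fun _ x => x - θ)
      (fun _ => by fun_prop)) (c := fun _ => 1) (s := Finset.univ)
    (fun i _ => by
      have := (measurePreserving_eval (fun _ : Fin n => gaussianReal θ 1) i)
      exact HasSubgaussianMGF.of_map (Y := Function.eval i) this.measurable.aemeasurable
        (by rw [this.map_eq]; exact gauss_subG θ))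
  simpa using h

noncomputable abbrev P (m n : ℕ) (θs : Fin m → ℝ) : Measure (Fin m → Fin n → ℝ) :=
  Measure.pi fun j : Fin m => Measure.pi fun _ : Fin n => gaussianReal (θs j) 1

lemma coord_subG (m n : ℕ) (θs : Fin m → ℝ) (j : Fin m) :
    HasSubgaussianMGF (fun X : Fin m → Fin n → ℝ => ∑ i, (X j i - θs j)) n (P m n θs) := by
  have := (measurePreserving_eval
    (fun j : Fin m => Measure.pi fun _ : Fin n => gaussianReal (θs j) 1) j)
  exact HasSubgaussianMGF.of_map (Y := Function.eval j) this.measurable.aemeasurable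
        (by rw [this.map_eq]; exact inner_subG n (θs j))

lemma sum_subG (m n : ℕ) (θs : Fin m → ℝ) (S : Finset (Fin m)) :
    HasSubgaussianMGF (fun X : Fin m → Fin n → ℝ => ∑ j ∈ S, ∑ i, (X j i - θs j))
      (m * n) (P m n θs) := by
  have h := HasSubgaussianMGF.sum_of_iIndepFun
    (iIndepFun_pi (μ := fun j : Fin m => Measure.pi fun _ : Fin n => gaussianReal (θs j) 1)
      (X := fun j w => ∑ i, (w i - θs j))
      (fun j => (inner_subG n (θs j)).aemeasurable)) (c := fun _ => (n : NNReal)) (s := S)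
    (fun j _ => coord_subG m n θs j)
  refine mono_subG h ?_
  rw [Finset.sum_const, nsmul_eq_mul]
  gcongr
  simpa using Finset.card_le_univ S

lemma prob (m n : ℕ) (hm : 2 ≤ m) (hn : 1 ≤ n) (θs : Fin m → ℝ) (S : Finset (Fin m))
    (t : ℝ) (ht : 1 ≤ t) :
    ENNReal.ofReal (1 - Real.exp (-t)) ≤ P m n θs
      {X | (∀ j, |∑ i, (X j i - θs j)| ≤ Real.sqrt (4 * n * (Real.log m + t))) ∧
        |∑ j ∈ S, ∑ i, (X j i - θs j)| ≤ Real.sqrt (6 * t * (m * n))} := by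
  have hm2 : (2 : ℝ) ≤ m := by exact_mod_cast hm
  have hn1 : (1 : ℝ) ≤ n := by exact_mod_cast hn
  have hlog : 0 ≤ Real.log m := Real.log_nonneg (by linarith)
  set μ := P m n θs with hμ
  set u1 := Real.sqrt (4 * n * (Real.log m + t)) with hu1
  set u2 := Real.sqrt (6 * t * (m * n)) with hu2
  set G := {X : Fin m → Fin n → ℝ | (∀ j, |∑ i, (X j i - θs j)| ≤ u1) ∧
        |∑ j ∈ S, ∑ i, (X j i - θs j)| ≤ u2} with hG
  set B1 : Fin m → Set (Fin m → Fin n → ℝ) := fun j => {X | u1 ≤ |∑ i, (X j i - θs j)|} with hB1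
  set B2 : Set (Fin m → Fin n → ℝ) := {X | u2 ≤ |∑ j ∈ S, ∑ i, (X j i - θs j)|} with hB2
  have hb1 : ∀ j, μ.real (B1 j) ≤ 2 * Real.exp (-(2 * (Real.log m + t))) := by
    intro j
    apply tail (coord_subG m n θs j) (Real.sqrt_nonneg _)
    rw [Real.sq_sqrt (by positivity)]
    simp only [NNReal.coe_natCast]
    field_simp
    ring
  have hb2 : μ.real B2 ≤ 2 * Real.exp (-(3 * t)) := by
    apply tail (sum_subG m n θs S) (Real.sqrt_nonneg _)
    rw [Real.sq_sqrt (by positivity)]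
    simp only [NNReal.coe_natCast, NNReal.coe_mul]
    field_simp
    ring
  have hcov : Set.univ ⊆ G ∪ ((⋃ j, B1 j) ∪ B2) := by
    intro X _
    by_cases h : X ∈ G
    · exact Or.inl h
    · right
      simp only [hG, Set.mem_ofPred_eq, not_and_or, not_forall, not_le] at h
      rcases h with ⟨j, hj⟩ | h
      · exact Or.inl (Set.mem_iUnion.2 ⟨j, hj.le⟩)
      · exact Or.inr h.le
  have h1 : 1 ≤ μ.real G + ((∑ j, μ.real (B1 j)) + μ.real B2) := by
    calc (1 : ℝ) = μ.real Set.univ := by simp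
      _ ≤ μ.real (G ∪ ((⋃ j, B1 j) ∪ B2)) := measureReal_mono hcov
      _ ≤ μ.real G + μ.real ((⋃ j, B1 j) ∪ B2) := measureReal_union_le _ _
      _ ≤ μ.real G + (μ.real (⋃ j, B1 j) + μ.real B2) := by
        gcongr; exact measureReal_union_le _ _
      _ ≤ _ := by
        gcongr; exact measureReal_iUnion_fintype_le _
  have h2 : ∑ j, μ.real (B1 j) ≤ Real.exp (-t) ^ 2 := by
    calc ∑ j, μ.real (B1 j) ≤ ∑ j : Fin m, 2 * Real.exp (-(2 * (Real.log m + t))) :=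
          Finset.sum_le_sum fun j _ => hb1 j
      _ = m * (2 * Real.exp (-(2 * (Real.log m + t)))) := by simp
      _ ≤ _ := by
        have e : Real.exp (-(2 * (Real.log m + t))) = ((m : ℝ)⁻¹) ^ 2 * Real.exp (-t) ^ 2 := by
          rw [← Real.exp_log (show (0 : ℝ) < m by linarith), ← Real.exp_neg, ← Real.exp_nat_mul,
            ← Real.exp_nat_mul, ← Real.exp_add, Real.log_exp]
          congr 1; push_cast; ring
        rw [e]
        have : (m : ℝ) * (2 * ((m : ℝ)⁻¹ ^ 2 * Real.exp (-t) ^ 2))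
          = (2 / m) * Real.exp (-t) ^ 2 := by field_simp
        rw [this]
        apply mul_le_of_le_one_left (by positivity)
        rw [div_le_one (by linarith)]
        exact hm2
  have h3 : Real.exp (-(3 * t)) = Real.exp (-t) ^ 3 := by
    rw [← Real.exp_nat_mul]; congr 1; push_cast; ring
  have hq : Real.exp (-t) ≤ 0.4 := by
    calc Real.exp (-t) ≤ Real.exp (-1) := Real.exp_le_exp.2 (by linarith)
      _ ≤ 0.4 := by
        have := Real.exp_neg_one_lt_d9
        linarith
  have hq0 := Real.exp_pos (-t)
  rw [h3] at hb2
  have h4 : 1 - Real.exp (-t) ≤ μ.real G := by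
    have h5 : Real.exp (-t) ^ 2 ≤ 0.4 * Real.exp (-t) := by nlinarith
    have h6 : Real.exp (-t) ^ 3 ≤ 0.16 * Real.exp (-t) := by nlinarith
    linarith
  calc ENNReal.ofReal (1 - Real.exp (-t)) ≤ ENNReal.ofReal (μ.real G) :=
        ENNReal.ofReal_le_ofReal h4
    _ = μ G := ofReal_measureReal

lemma quad (n : ℕ) (hn : 1 ≤ n) (w : Fin n → ℝ) (v : ℝ) :
    (1 / (2 * (n : ℝ))) * ∑ i, (w i - v) ^ 2 =
      ((1 / (2 * (n : ℝ))) * ∑ i, (w i) ^ 2 - ((∑ i, w i) / n) ^ 2 / 2)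
        + ((∑ i, w i) / n - v) ^ 2 / 2 := by
  have hn1 : (n : ℝ) ≠ 0 := by positivity
  have : ∑ i, (w i - v) ^ 2 = ∑ i, (w i) ^ 2 - 2 * v * ∑ i, w i + n * v ^ 2 := by
    simp only [sub_sq, Finset.sum_add_distrib, Finset.sum_sub_distrib, Finset.mul_sum]
    simp
    apply Finset.sum_congr rfl; intros; ring
  rw [this]
  field_simp
  ring

end Armul

/-- Adaptivity and robustness of ARMUL for multi-task Gaussian mean estimation:
with probability at least `1 - e^{-t}`, every minimizer of the ARMUL objective is
simultaneously close to all the true means, with a finer bound on the similar tasks `S`. -/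
theorem stmt_3 : ∃ C > (0 : ℝ),
    ∀ (m n : ℕ), 2 ≤ m → 1 ≤ n →
    ∀ (ε δ : ℝ), 0 ≤ ε → ε < 1 / 2 → 0 ≤ δ →
    ∀ (θs : Fin m → ℝ) (S : Finset (Fin m)),
      ((Sᶜ : Finset (Fin m)).card : ℝ) ≤ ε * m →
      (∃ θ0 : ℝ, ∀ j ∈ S, |θs j - θ0| ≤ δ) →
    ∀ (t c : ℝ), 1 ≤ t → ε ≤ c → c < 1 / 2 →
    ∀ lam : ℝ, lam = (5 / (1 - 2 * c)) * Real.sqrt (2 * (Real.log m + t) / n) →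
      ENNReal.ofReal (1 - Real.exp (-t)) ≤
        (Measure.pi fun j : Fin m => Measure.pi fun _ : Fin n =>
            ProbabilityTheory.gaussianReal (θs j) 1)
          {X : Fin m → Fin n → ℝ |
            ∀ (θhat : Fin m → ℝ) (θc : ℝ),
              (∀ (θ : Fin m → ℝ) (c' : ℝ),
                ∑ j, ((1 / (2 * (n : ℝ))) * ∑ i, (X j i - θhat j) ^ 2
                    + lam * |θhat j - θc|) ≤
                ∑ j, ((1 / (2 * (n : ℝ))) * ∑ i, (X j i - θ j) ^ 2
                    + lam * |θ j - c'|)) →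
              (∀ j ∈ S, |θhat j - θs j| <
                (C / (1 - 2 * c) ^ 2) *
                  (Real.sqrt (t / (m * n)) + min δ (Real.sqrt ((Real.log m + t) / n))
                    + ε * Real.sqrt ((Real.log m + t) / n))) ∧
              (∀ j ∈ Sᶜ, |θhat j - θs j| <
                (C / (1 - 2 * c) ^ 2) * Real.sqrt ((Real.log m + t) / n))} := by
  refine ⟨20, by norm_num, ?_⟩
  intro m n hm hn ε δ hε hε2 hδ θs S hcard hθ t c ht hεc hc lam hlam
  obtain ⟨θ0, hθ0⟩ := hθ
  refine (Armul.prob m n hm hn θs S t ht).trans (measure_mono ?_)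
  rintro X ⟨hX1, hX2⟩ y z hmin
  have hm2 : (2 : ℝ) ≤ m := by exact_mod_cast hm
  have hn1 : (1 : ℝ) ≤ n := by exact_mod_cast hn
  have hlog : 0 ≤ Real.log m := Real.log_nonneg (by linarith)
  have hk0 : 0 < 1 - 2 * c := by linarith
  set s := Real.sqrt ((Real.log m + t) / n) with hs
  have hs0 : 0 < s := Real.sqrt_pos.2 (by positivity)
  have hτ0 : 0 < Real.sqrt (t / (m * n)) := Real.sqrt_pos.2 (by positivity)
  have hlk : lam * (1 - 2 * c) = 5 * Real.sqrt 2 * s := by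
    rw [hlam, mul_div_assoc, Real.sqrt_mul (by norm_num), ← hs]
    field_simp
  have hr1 : (1.4 : ℝ) ≤ Real.sqrt 2 := Real.le_sqrt_of_sq_le (by norm_num)
  have hr2 : Real.sqrt 2 ≤ (1.42 : ℝ) := Real.sqrt_le_iff.2 (by norm_num)
  have hlam0 : 0 ≤ lam := by rw [hlam]; positivity
  have hfoc := Armul.foc (by omega : 0 < m) hlam0 (fun j => (∑ i, X j i) / n) y
    (fun j => (1 / (2 * (n : ℝ))) * ∑ i, (X j i) ^ 2 - ((∑ i, X j i) / n) ^ 2 / 2) z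
    (by
      intro θ c'
      have := hmin θ c'
      simp only [Armul.quad n hn] at this
      exact this)
  have hnoise : ∀ j, (∑ i, X j i) / n - θs j = (∑ i, (X j i - θs j)) / n := by
    intro j
    rw [Finset.sum_sub_distrib]
    simp
    field_simp
  refine Armul.det hs0 hτ0 S (by omega) hε hε2 hδ hcard (by linarith) hk0 (by linarith)
    ?_ ?_ (fun j => (∑ i, X j i) / n) y θs z θ0 hθ0 ?_ ?_ hfoc.1 hfoc.2
  · rw [hlk]; nlinarith
  · rw [hlk]; nlinarith
  · intro j
    simp only [hnoise]
    rw [abs_div, abs_of_nonneg (by positivity : (0 : ℝ) ≤ n), div_le_iff₀ (by positivity)]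
    refine (hX1 j).trans ?_
    apply Real.sqrt_le_iff.2 ⟨by positivity, ?_⟩
    rw [mul_pow, mul_pow, hs, Real.sq_sqrt (by positivity)]
    apply le_of_eq
    field_simp
    norm_num
  · simp only [hnoise]
    rw [← Finset.sum_div, abs_div, abs_of_nonneg (by positivity : (0 : ℝ) ≤ n),
      div_le_iff₀ (by positivity)]
    refine hX2.trans ?_
    apply Real.sqrt_le_iff.2 ⟨by positivity, ?_⟩
    rw [mul_pow, mul_pow, mul_pow, Real.sq_sqrt (by positivity)]
    have : (2.5 : ℝ) ^ 2 * (t / (m * n) * m ^ 2) * n ^ 2 = 6.25 * (t * (m * n)) := by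
      field_simp
      norm_num
    rw [this]
    have : 0 ≤ t * (m * n) := by positivity
    linarith
end

section
/- Let d ≥ 1, θ* ∈ ℝ^d, M > 0, ρ > 0, and let f : ℝ^d → ℝ be convex and twice continuously differentiable with ∇²f(θ) ⪰ ρ·I for all θ in the closed ball B(θ*, M) and ‖∇f(θ*)‖₂ ≤ ρM/2. Let 0 ≤ λ < ρM/2. Then f has a unique global minimizer θ̃, it satisfies ‖θ̃ − θ*‖₂ ≤ ‖∇f(θ*)‖₂/ρ, and for every γ ∈ ℝ^d, every global minimizer θ̂ of the function θ ↦ f(θ) + λ‖θ − γ‖₂ satisfies ‖θ̂ − θ̃‖₂ ≤ λ/ρ. -/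
open Metric

/-- The quadratic form of the Hessian of `f` at `θ`, evaluated at `v`. -/
noncomputable def hessQ {d : ℕ} (f : EuclideanSpace ℝ (Fin d) → ℝ)
    (θ v : EuclideanSpace ℝ (Fin d)) : ℝ :=
  iteratedFDeriv ℝ 2 f θ ![v, v]

theorem aux_deriv_nonneg (φ : ℝ → ℝ) (c : ℝ) (h : HasDerivAt φ c 0)
    (hmin : ∀ t : ℝ, 0 < t → t < 1 → φ 0 ≤ φ t) : 0 ≤ c := by
  have h1 : HasDerivWithinAt φ c (Set.Ioi 0) 0 := h.hasDerivWithinAt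
  rw [hasDerivWithinAt_iff_tendsto_slope' (by simp)] at h1
  refine ge_of_tendsto h1 ?_
  filter_upwards [Ioo_mem_nhdsGT (show (0:ℝ) < 1 by norm_num)] with t ht
  rw [slope_def_field]
  exact div_nonneg (by linarith [hmin t ht.1 ht.2]) (by linarith [ht.1])

theorem aux_line {E : Type*} [NormedAddCommGroup E] [NormedSpace ℝ E] (a u : E) (t : ℝ) :
    HasDerivAt (fun s : ℝ => a + s • u) u t := by
  simpa using ((hasDerivAt_id t).smul_const u).const_add a

theorem aux_line_f {E : Type*} [NormedAddCommGroup E] [NormedSpace ℝ E] (f : E → ℝ)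
    (hf : Differentiable ℝ f) (a u : E) (t : ℝ) :
    HasDerivAt (fun s : ℝ => f (a + s • u)) (fderiv ℝ f (a + t • u) u) t :=
  (hf (a + t • u)).hasFDerivAt.comp_hasDerivAt t (aux_line a u t)

theorem aux_mono {E : Type*} [NormedAddCommGroup E] [NormedSpace ℝ E] (f : E → ℝ)
    (hf : Differentiable ℝ f) (hc : ConvexOn ℝ Set.univ f) (a u : E) :
    Monotone (fun t : ℝ => fderiv ℝ f (a + t • u) u) := by
  have hφ : ConvexOn ℝ Set.univ (fun s : ℝ => f (a + s • u)) := by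
    refine ⟨convex_univ, fun x _ y _ p q hp hq hpq => ?_⟩
    have := hc.2 (Set.mem_univ (a + x • u)) (Set.mem_univ (a + y • u)) hp hq hpq
    convert this using 2
    have : a = (p + q) • a := by rw [hpq, one_smul]
    nth_rewrite 1 [this]
    simp only [smul_eq_mul]
    module
  have := hφ.monotoneOn_deriv (fun x _ => (aux_line_f f hf a u x).differentiableAt)
  intro x y hxy
  have h := this (Set.mem_univ x) (Set.mem_univ y) hxy
  rwa [(aux_line_f f hf a u x).deriv, (aux_line_f f hf a u y).deriv] at h

theorem aux_strong {d : ℕ} (θs : EuclideanSpace ℝ (Fin d)) (M ρ : ℝ)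
    (f : EuclideanSpace ℝ (Fin d) → ℝ) (hC2 : ContDiff ℝ 2 f)
    (hhess : ∀ θ ∈ closedBall θs M, ∀ v, ρ * ‖v‖ ^ 2 ≤ hessQ f θ v)
    (a u : EuclideanSpace ℝ (Fin d)) (ha : a ∈ closedBall θs M) (t : ℝ) (ht : 0 ≤ t)
    (hb : a + t • u ∈ closedBall θs M) :
    ρ * ‖u‖ ^ 2 * t ≤ fderiv ℝ f (a + t • u) u - fderiv ℝ f a u := by
  have hd1 : Differentiable ℝ (fderiv ℝ f) :=
    (hC2.fderiv_right (m := 1) (by norm_num)).differentiable (by norm_num)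
  have hder : ∀ s : ℝ, HasDerivAt (fun s : ℝ => fderiv ℝ f (a + s • u) u)
      (fderiv ℝ (fderiv ℝ f) (a + s • u) u u) s := by
    intro s
    have := (hd1 (a + s • u)).hasFDerivAt.comp_hasDerivAt s (aux_line a u s)
    simpa using this.clm_apply (hasDerivAt_const s u)
  have key := (convex_Icc (0:ℝ) t).mul_sub_le_image_sub_of_le_deriv
    (f := fun s : ℝ => fderiv ℝ f (a + s • u) u) (C := ρ * ‖u‖ ^ 2)
    (fun s _ => (hder s).continuousAt.continuousWithinAt)
    (fun s _ => (hder s).differentiableAt.differentiableWithinAt) ?_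
    0 (by simp [ht]) t (by simp [ht]) ht
  · simpa using key
  · intro s hs
    rw [interior_Icc] at hs
    rw [(hder s).deriv]
    have hmem : a + s • u ∈ closedBall θs M := by
      have ht0 : 0 < t := hs.1.trans hs.2
      have := (convex_closedBall θs M) ha hb (a := 1 - s / t) (b := s / t)
        (by rw [sub_nonneg, div_le_one ht0]; exact hs.2.le) (div_nonneg hs.1.le ht) (by ring)
      convert this using 1
      rw [smul_add, smul_smul, div_mul_cancel₀ _ ht0.ne']
      module
    have := hhess _ hmem u
    rw [hessQ, iteratedFDeriv_two_apply] at this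
    simpa using this

theorem aux_key {d : ℕ} (θs : EuclideanSpace ℝ (Fin d)) (M ρ : ℝ)
    (hM : 0 < M) (hρ : 0 < ρ) (f : EuclideanSpace ℝ (Fin d) → ℝ)
    (hconv : ConvexOn ℝ Set.univ f) (hC2 : ContDiff ℝ 2 f)
    (hhess : ∀ θ ∈ closedBall θs M, ∀ v, ρ * ‖v‖ ^ 2 ≤ hessQ f θ v)
    (lam : ℝ) (hlam : lam < ρ * M / 2) (a x : EuclideanSpace ℝ (Fin d))
    (ha : ‖a - θs‖ ≤ M / 2) (h0 : fderiv ℝ f a = 0)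
    (hx : fderiv ℝ f x (x - a) ≤ lam * ‖x - a‖) (hlam0 : 0 ≤ lam) : ‖x - a‖ ≤ lam / ρ := by
  have hdf : Differentiable ℝ f := hC2.differentiable (by norm_num)
  rcases (norm_nonneg (x - a)).eq_or_lt with h | hpos
  · rw [← h]; positivity
  have main : ∀ t : ℝ, 0 ≤ t → t ≤ 1 → t * ‖x - a‖ ≤ M / 2 → ρ * (t * ‖x - a‖) ≤ lam := by
    intro t ht0 ht1 htM
    have h1 := aux_strong θs M ρ f hC2 hhess a (x - a)
      (by rw [mem_closedBall, dist_eq_norm]; linarith) t ht0 (by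
        rw [mem_closedBall, dist_eq_norm, show a + t • (x - a) - θs = (a - θs) + t • (x - a) by abel]
        refine (norm_add_le _ _).trans ?_
        rw [norm_smul, Real.norm_of_nonneg ht0]; linarith)
    have h2 := aux_mono f hdf hconv a (x - a) ht1
    simp only [one_smul, add_sub_cancel] at h2
    rw [h0] at h1
    simp only [ContinuousLinearMap.zero_apply, sub_zero] at h1
    refine le_of_mul_le_mul_right ?_ hpos
    nlinarith
  rcases le_or_gt ‖x - a‖ (M / 2) with h | h
  · have := main 1 (by norm_num) le_rfl (by linarith)
    rw [le_div_iff₀ hρ]; linarith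
  · exfalso
    have e : M / 2 / ‖x - a‖ * ‖x - a‖ = M / 2 := div_mul_cancel₀ _ hpos.ne'
    have := main (M / 2 / ‖x - a‖) (by positivity) (by rw [div_le_one hpos]; exact h.le) e.le
    rw [e] at this
    linarith

/-- Personalization: for a strongly convex loss, the penalized minimizer stays within
`λ/ρ` of the unique unpenalized minimizer, which itself is within `‖∇f(θ*)‖/ρ` of `θ*`. -/
theorem stmt_5 {d : ℕ} (hd : 1 ≤ d) (θs : EuclideanSpace ℝ (Fin d)) (M ρ : ℝ)
    (hM : 0 < M) (hρ : 0 < ρ) (f : EuclideanSpace ℝ (Fin d) → ℝ)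
    (hconv : ConvexOn ℝ Set.univ f) (hC2 : ContDiff ℝ 2 f)
    (hhess : ∀ θ ∈ closedBall θs M, ∀ v, ρ * ‖v‖ ^ 2 ≤ hessQ f θ v)
    (hgrad : ‖gradient f θs‖ ≤ ρ * M / 2)
    (lam : ℝ) (hlam0 : 0 ≤ lam) (hlam : lam < ρ * M / 2) :
    ∃ θt : EuclideanSpace ℝ (Fin d),
      (∀ θ, f θt ≤ f θ) ∧
      (∀ θ', (∀ θ, f θ' ≤ f θ) → θ' = θt) ∧
      ‖θt - θs‖ ≤ ‖gradient f θs‖ / ρ ∧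
      ∀ (γ θh : EuclideanSpace ℝ (Fin d)),
        (∀ θ, f θh + lam * ‖θh - γ‖ ≤ f θ + lam * ‖θ - γ‖) →
        ‖θh - θt‖ ≤ lam / ρ := by
  have hdf : Differentiable ℝ f := hC2.differentiable (by norm_num)
  have hgn : ‖gradient f θs‖ = ‖fderiv ℝ f θs‖ := by simp [gradient]
  obtain ⟨a, ha, hmin⟩ := (isCompact_closedBall θs M).exists_isMinOn
    (nonempty_closedBall.2 hM.le) hdf.continuous.continuousOn
  have hvar : 0 ≤ fderiv ℝ f a (θs - a) := by
    have := aux_line_f f hdf a (θs - a) 0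
    simp only [zero_smul, add_zero] at this
    refine aux_deriv_nonneg _ _ this ?_
    intro t ht0 ht1
    simp only [zero_smul, add_zero]
    refine hmin ?_
    exact (convex_closedBall θs M).add_smul_sub_mem ha (mem_closedBall_self hM.le) ⟨ht0.le, ht1.le⟩
  have hbound : ‖a - θs‖ ≤ ‖gradient f θs‖ / ρ := by
    rw [hgn]
    rcases (norm_nonneg (a - θs)).eq_or_lt with h | hpos
    · rw [← h]; positivity
    have h1 := aux_strong θs M ρ f hC2 hhess θs (a - θs) (mem_closedBall_self hM.le) 1
      (by norm_num) (by simpa using ha)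
    simp only [one_smul, add_sub_cancel] at h1
    have h2 : fderiv ℝ f a (a - θs) = - fderiv ℝ f a (θs - a) := by
      rw [← map_neg, neg_sub]
    have h3 := (fderiv ℝ f θs).le_opNorm (a - θs)
    have h4 := neg_abs_le (fderiv ℝ f θs (a - θs))
    rw [Real.norm_eq_abs] at h3
    rw [le_div_iff₀ hρ]
    refine le_of_mul_le_mul_right ?_ hpos
    nlinarith
  have haM : ‖a - θs‖ ≤ M / 2 := by
    refine hbound.trans ?_
    rw [div_le_iff₀ hρ]; linarith
  have hloc : IsLocalMin f a := hmin.isLocalMin (by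
    refine Filter.mem_of_superset (isOpen_ball.mem_nhds ?_) ball_subset_closedBall
    rw [mem_ball, dist_eq_norm]; linarith)
  have h0 : fderiv ℝ f a = 0 := hloc.fderiv_eq_zero
  refine ⟨a, IsMinOn.of_isLocalMin_of_convex_univ hloc hconv, ?_, hbound, ?_⟩
  · intro x hx
    have hx0 : fderiv ℝ f x = 0 :=
      IsLocalMin.fderiv_eq_zero (Filter.Eventually.of_forall hx)
    have := aux_key θs M ρ hM hρ f hconv hC2 hhess 0 (by positivity) a x haM h0
      (by simp [hx0]) le_rfl
    rw [zero_div] at this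
    exact sub_eq_zero.1 (norm_le_zero_iff.1 this)
  · intro γ x hx
    refine aux_key θs M ρ hM hρ f hconv hC2 hhess lam hlam a x haM h0 ?_ hlam0
    have h1 := aux_line_f f hdf x (a - x) 0
    simp only [zero_smul, add_zero] at h1
    have h2 := h1.add ((hasDerivAt_id (0:ℝ)).mul_const (lam * ‖x - a‖))
    have h3 := aux_deriv_nonneg _ _ h2 ?_
    · rw [← neg_sub x a, map_neg] at h3
      linarith
    · intro t ht0 ht1
      simp only [Pi.add_apply, id, zero_smul, add_zero, zero_mul]
      have h4 := hx (x + t • (a - x))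
      have h5 : ‖x + t • (a - x) - γ‖ ≤ ‖x - γ‖ + t * ‖x - a‖ := by
        rw [show x + t • (a - x) - γ = (x - γ) + t • (a - x) by abel]
        refine (norm_add_le _ _).trans ?_
        rw [norm_smul, Real.norm_of_nonneg ht0.le, norm_sub_rev a x]
      have h6 := mul_le_mul_of_nonneg_left h5 hlam0
      linarith
end

section
/- Let d, m ≥ 1, let f_1,…,f_m : ℝ^d → ℝ be convex functions, w_1,…,w_m > 0 weights, θ*_1,…,θ*_m ∈ ℝ^d, M > 0, 0 < ρ ≤ L < ∞, ε ≥ 0, δ ≥ 0, and let S ⊆ {1,…,m} be nonempty such that: (i) for each j ∈ S, f_j is (θ*_j, M, ρ, L)-regular; (ii) min_{θ∈ℝ^d} max_{j∈S} √w_j·‖θ*_j − θ‖₂ ≤ δ; (iii) Σ_{j∈S^c} √w_j ≤ ε·(Σ_{j∈S} w_j)/(max_{j∈S} √w_j). Set κ = L/ρ and κ_w = (max_{j∈S} √w_j)·(Σ_{j∈S} √w_j)/(Σ_{j∈S} w_j). Suppose κε < 1 and (5κκ_w/(1 − κε))·max_{j∈S} {√w_j·‖∇f_j(θ*_j)‖₂}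 < λ < (ρM/2)·min_{j∈S} √w_j. Then every minimizer (θ̂_1,…,θ̂_m, β̂) of (θ_1,…,θ_m,β) ↦ Σ_{j=1}^m w_j( f_j(θ_j) + (λ/√w_j)‖θ_j − β‖₂ ) satisfies, for all j ∈ S, ‖θ̂_j − θ*_j‖₂ ≤ ‖Σ_{k∈S} w_k·∇f_k(θ*_k)‖₂/(ρ·Σ_{k∈S} w_k) + (6/((1 − κε)·√w_j))·min{ 3κ²κ_w·δ, 2λ/(5ρ) } + ελ/(ρ·max_{k∈S} √w_k). Moreover, there exists a universal constant C > 0 such that if additionally ε = 0 and C·κκ_w·L·δ < λ, then θ̂_1 = ⋯ = θ̂_m and this common value is a global minimizer of θ ↦ Σ_{j=1}^m w_j f_j(θ). -/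
open Metric Finset

/-- `f` is `(θ*, M, ρ, L)`-regular: convex, `C²`, with Hessian eigenvalues in `[ρ, L]`
on the closed ball `B(θ*, M)`, and `‖∇f(θ*)‖ ≤ ρM/2`. -/
def ARMULRegular {d : ℕ} (f : EuclideanSpace ℝ (Fin d) → ℝ)
    (θs : EuclideanSpace ℝ (Fin d)) (M ρ L : ℝ) : Prop :=
  ConvexOn ℝ Set.univ f ∧ ContDiff ℝ 2 f ∧
  (∀ θ ∈ closedBall θs M, ∀ v,
    ρ * ‖v‖ ^ 2 ≤ hessQ f θ v ∧ hessQ f θ v ≤ L * ‖v‖ ^ 2) ∧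
  ‖gradient f θs‖ ≤ ρ * M / 2

abbrev EE (d : ℕ) := EuclideanSpace ℝ (Fin d)

theorem aux_deriv {E : Type*} [NormedAddCommGroup E] [InnerProductSpace ℝ E] [CompleteSpace E]
    {h : E → ℝ} {x g v : E} {c : ℝ}
    (hg : HasGradientAt h g x)
    (H : ∀ t : ℝ, 0 ≤ t → t ≤ 1 → t * c ≤ h (x + t • v) - h x) : c ≤ inner ℝ g v := by
  have h1 : HasDerivAt (fun t : ℝ => x + t • v) v 0 := by
    simpa using ((hasDerivAt_id (0:ℝ)).smul_const v).const_add x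
  have h2 : HasFDerivAt h ((InnerProductSpace.toDual ℝ E) g) (x + (0:ℝ) • v) := by
    simpa using hg.hasFDerivAt
  have h3 : HasDerivAt (fun t : ℝ => h (x + t • v)) (inner ℝ g v) 0 := by
    have := h2.comp_hasDerivAt (0:ℝ) h1
    rw [InnerProductSpace.toDual_apply_apply] at this
    exact this
  have h4 := h3.tendsto_slope_zero_right
  refine ge_of_tendsto h4 ?_
  have : Set.Ioo (0:ℝ) 1 ∈ nhdsWithin (0:ℝ) (Set.Ioi 0) := Ioo_mem_nhdsGT one_pos
  filter_upwards [this] with t ht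
  have := H t ht.1.le ht.2.le
  simp only [zero_add, zero_smul, add_zero, smul_eq_mul]
  rw [inv_mul_eq_div, le_div_iff₀ ht.1]
  linarith

theorem aux_grad_ineq {E : Type*} [NormedAddCommGroup E] [InnerProductSpace ℝ E] [CompleteSpace E]
    {h : E → ℝ} {x g : E} (hg : HasGradientAt h g x)
    (hc : ConvexOn ℝ Set.univ h) (y : E) : inner ℝ g (y - x) ≤ h y - h x := by
  have hg' : HasGradientAt (fun z => - h z) (-g) x := by
    have := hg.hasFDerivAt.neg
    rw [hasGradientAt_iff_hasFDerivAt]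
    rw [map_neg]
    exact this
  have := aux_deriv (v := y - x) (c := -(h y - h x)) hg' (fun t h0 h1 => by
    have := hc.2 (Set.mem_univ x) (Set.mem_univ y) (sub_nonneg.2 h1) h0 (by ring)
    have e : (1 - t) • x + t • y = x + t • (y - x) := by module
    rw [e] at this
    simp only [smul_eq_mul] at this
    linarith)
  rw [inner_neg_left] at this
  linarith

theorem aux_mono_s6 {E : Type*} [NormedAddCommGroup E] [InnerProductSpace ℝ E] [CompleteSpace E]
    {h : E → ℝ} (hd : Differentiable ℝ h)
    (hc : ConvexOn ℝ Set.univ h) (x y : E) :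
    0 ≤ inner ℝ (gradient h x - gradient h y) (x - y) := by
  have h1 := aux_grad_ineq (hd x).hasGradientAt hc y
  have h2 := aux_grad_ineq (hd y).hasGradientAt hc x
  rw [← neg_sub x y, inner_neg_right] at h1
  rw [inner_sub_left]
  linarith

theorem aux_strong_s6 {d : ℕ} {f : EE d → ℝ} {θs : EE d} {M ρ L : ℝ}
    (hf : ARMULRegular f θs M ρ L) {x y : EE d} (hx : x ∈ closedBall θs M)
    (hy : y ∈ closedBall θs M) :
    ρ * ‖x - y‖ ^ 2 ≤ inner ℝ (gradient f x - gradient f y) (x - y) := by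
  obtain ⟨hc, hC, hH, -⟩ := hf
  have hd : Differentiable ℝ f := hC.differentiable (by norm_num)
  have hd2 : Differentiable ℝ (fderiv ℝ f) :=
    (hC.fderiv_right (m := 1) (by norm_num)).differentiable (by norm_num)
  set v := x - y with hv
  have hin : ∀ z, inner ℝ (gradient f z) v = fderiv ℝ f z v := by
    intro z; simp [gradient]
  rw [inner_sub_left, hin, hin]
  have hder : ∀ t : ℝ, HasDerivAt (fun t : ℝ => fderiv ℝ f (y + t • v) v)
      (hessQ f (y + t • v) v) t := by
    intro t
    have h1 : HasDerivAt (fun t : ℝ => y + t • v) v t := by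
      simpa using ((hasDerivAt_id t).smul_const v).const_add y
    have h2 := (hd2 (y + t • v)).hasFDerivAt.comp_hasDerivAt t h1
    have h3 := h2.clm_apply (hasDerivAt_const t v)
    simpa [hessQ, iteratedFDeriv_two_apply] using h3
  obtain ⟨c, hc, hce⟩ := exists_hasDerivAt_eq_slope (fun t : ℝ => fderiv ℝ f (y + t • v) v)
    (fun t => hessQ f (y + t • v) v) (zero_lt_one)
    (fun t _ => (hder t).continuousAt.continuousWithinAt) (fun t _ => hder t)
  have hmem : y + c • v ∈ closedBall θs M := by
    have := (convex_closedBall θs M) hy hx (sub_nonneg.2 hc.2.le) hc.1.le (by ring)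
    convert this using 1
    rw [hv]; module
  have := (hH _ hmem v).1
  simp only [one_smul, zero_smul, add_zero, sub_zero, div_one] at hce
  rw [hce] at this
  have e : y + v = x := by rw [hv]; abel
  rwa [e] at this

theorem aux_lip {d : ℕ} {f : EE d → ℝ} {θs : EE d} {M ρ L : ℝ} (hρ : 0 < ρ) (hρL : ρ ≤ L)
    (hf : ARMULRegular f θs M ρ L) {x y : EE d} (hx : x ∈ closedBall θs M)
    (hy : y ∈ closedBall θs M) :
    ‖gradient f x - gradient f y‖ ≤ L * ‖x - y‖ := by
  obtain ⟨hc, hC, hH, -⟩ := hf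
  have hd2 : Differentiable ℝ (fderiv ℝ f) :=
    (hC.fderiv_right (m := 1) (by norm_num)).differentiable (by norm_num)
  have hL : 0 ≤ L := by linarith
  have e : ‖gradient f x - gradient f y‖ = ‖fderiv ℝ f x - fderiv ℝ f y‖ := by
    simp only [gradient]
    rw [← map_sub, LinearIsometryEquiv.norm_map]
  rw [e]
  refine (convex_closedBall θs M).norm_image_sub_le_of_norm_fderiv_le (𝕜 := ℝ)
    (fun z _ => hd2 z) (fun z hz => ?_) hy hx
  set B := fderiv ℝ (fderiv ℝ f) z with hB
  have hsym : ∀ u v, B u v = B v u := by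
    have : IsSymmSndFDerivAt ℝ f z := hC.contDiffAt.isSymmSndFDerivAt (by simp)
    exact fun u v => this u v
  have hq : ∀ v, hessQ f z v = B v v := by
    intro v; simp [hessQ, iteratedFDeriv_two_apply, hB]
  have hq0 : ∀ v, 0 ≤ B v v := fun v => by
    have := (hH z hz v).1
    rw [hq] at this
    exact le_trans (by positivity) this
  have hqL : ∀ v, B v v ≤ L * ‖v‖ ^ 2 := fun v => by
    have := (hH z hz v).2
    rwa [hq] at this
  have hpol : ∀ u v, ‖u‖ = 1 → ‖v‖ = 1 → B u v ≤ L := by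
    intro u v hu hv
    have h1 := hq0 (u - v)
    have h2 := hqL u
    have h3 := hqL v
    have h4 := hsym u v
    rw [hu] at h2; rw [hv] at h3
    simp only [map_sub, sub_apply] at h1
    linarith
  refine ContinuousLinearMap.opNorm_le_bound _ hL (fun u => ?_)
  refine ContinuousLinearMap.opNorm_le_bound _ (by positivity) (fun v => ?_)
  have key : ∀ u v, B u v ≤ L * ‖u‖ * ‖v‖ := by
    intro u v
    by_cases hu : u = 0
    · simp [hu]
    by_cases hv : v = 0
    · simp [hv]
    have hu' : 0 < ‖u‖ := norm_pos_iff.2 hu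
    have hv' : 0 < ‖v‖ := norm_pos_iff.2 hv
    have := hpol (‖u‖⁻¹ • u) (‖v‖⁻¹ • v) (by simp [norm_smul, hu'.ne']) (by simp [norm_smul, hv'.ne'])
    simp only [map_smul, smul_apply, smul_eq_mul] at this
    rw [← mul_assoc, ← mul_inv_rev, inv_mul_le_iff₀ (by positivity)] at this
    linarith
  rw [Real.norm_eq_abs, abs_le]
  have h1 := key u v
  have h2 := key (-u) v
  simp only [map_neg, neg_apply, norm_neg] at h2
  constructor <;> linarith

theorem aux_scalar {lam ρ L ε δ κ κw W1 G : ℝ} (hlam : 0 < lam) (hρ : 0 < ρ) (hρL : ρ ≤ L)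
    (hε : 0 ≤ ε) (hδ : 0 ≤ δ) (hκ : κ = L / ρ) (hκw : 1 ≤ κw) (hκε : κ * ε < 1) (hW1 : 0 < W1)
    (hG0 : 0 ≤ G) (hG : 5 * κ * κw * G ≤ (1 - κ * ε) * lam)
    (hδL : κ * κw * L * δ ≤ 2 / 15 * ((1 - κ * ε) * lam)) :
    ∃ r : ℝ, 0 < r ∧ G + L * (W1 * r + δ) < lam ∧
      lam * ε / W1 + κw * (G + L * δ) / W1 < ρ * r := by
  have hκ1 : 1 ≤ κ := by rw [hκ, le_div_iff₀ hρ]; linarith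
  have hLe : L = κ * ρ := by rw [hκ]; field_simp
  have hp : 0 < (1 - κ * ε) * lam := mul_pos (by linarith) hlam
  have hA : κ * κw * (G + L * δ) ≤ 1 / 3 * ((1 - κ * ε) * lam) := by linarith
  have hA0 : 0 ≤ G + L * δ := by
    have : 0 ≤ L := by linarith
    positivity
  have hA1 : G + L * δ ≤ 1 / 3 * ((1 - κ * ε) * lam) := by
    refine le_trans ?_ hA
    exact le_mul_of_one_le_left hA0 (by nlinarith)
  refine ⟨(lam * ε + (1 - κ * ε) * lam / (2 * κ)) / (ρ * W1), by positivity, ?_, ?_⟩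
  · have : L * (W1 * ((lam * ε + (1 - κ * ε) * lam / (2 * κ)) / (ρ * W1)))
        = κ * ε * lam + (1 - κ * ε) * lam / 2 := by
      rw [hLe]; field_simp
    rw [mul_add, this]
    linarith
  · have e : ρ * ((lam * ε + (1 - κ * ε) * lam / (2 * κ)) / (ρ * W1))
        = (lam * ε + (1 - κ * ε) * lam / (2 * κ)) / W1 := by
      field_simp
    rw [e, ← add_div]
    refine div_lt_div_of_pos_right ?_ hW1
    have : κw * (G + L * δ) < (1 - κ * ε) * lam / (2 * κ) := by
      rw [lt_div_iff₀ (by positivity)]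
      linarith
    linarith

theorem aux_sumnorm {ι E : Type*} [NormedAddCommGroup E] [InnerProductSpace ℝ E]
    (S : Finset ι) (a : ι → ℝ) (u : ι → E) (c : ℝ) (ha : ∀ j ∈ S, 0 < a j)
    (h : ∀ j ∈ S, a j * ‖u j‖ ≤ c) :
    ‖∑ j ∈ S, a j ^ 2 • u j‖ ≤ c * ∑ j ∈ S, a j := by
  rw [Finset.mul_sum]
  refine norm_sum_le_of_le _ (fun j hj => ?_)
  rw [norm_smul, Real.norm_of_nonneg (sq_nonneg _)]
  have := mul_le_mul_of_nonneg_right (h j hj) (ha j hj).le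
  linarith

theorem aux_core {ι E : Type*} [NormedAddCommGroup E] [InnerProductSpace ℝ E]
    (S : Finset ι) (hS : S.Nonempty) (g : ι → E → E) (a : ι → ℝ) (θs θh : ι → E) (θ0 β : E)
    {M lam ρ L ε δ κ κw W1 G : ℝ} (hM : 0 < M)
    (ha : ∀ j ∈ S, 0 < a j) (haW : ∀ j ∈ S, a j ≤ W1)
    (hmono : ∀ j ∈ S, ∀ x y, 0 ≤ inner ℝ (g j x - g j y) (x - y))
    (hstrong : ∀ j ∈ S, ∀ x ∈ closedBall (θs j) M, ∀ y ∈ closedBall (θs j) M,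
      ρ * ‖x - y‖ ^ 2 ≤ inner ℝ (g j x - g j y) (x - y))
    (hlip : ∀ j ∈ S, ∀ x ∈ closedBall (θs j) M, ‖g j x - g j (θs j)‖ ≤ L * ‖x - θs j‖)
    (hlam : 0 < lam) (hρ : 0 < ρ) (hρL : ρ ≤ L)
    (hε : 0 ≤ ε) (hδ : 0 ≤ δ) (hκ : κ = L / ρ) (hκw1 : 1 ≤ κw)
    (hκw : κw = W1 * (∑ j ∈ S, a j) / ∑ j ∈ S, a j ^ 2)
    (hκε : κ * ε < 1) (hW1 : 0 < W1)
    (hG0 : 0 ≤ G) (hG : 5 * κ * κw * G ≤ (1 - κ * ε) * lam)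
    (hδL : κ * κw * L * δ ≤ 2 / 15 * ((1 - κ * ε) * lam))
    (hgs : ∀ j ∈ S, a j * ‖g j (θs j)‖ ≤ G)
    (hθ0 : ∀ j ∈ S, a j * ‖θs j - θ0‖ ≤ δ)
    (hlamM : ∀ j ∈ S, lam < ρ * M / 2 * a j)
    (hO2 : ∀ j ∈ S, lam / a j * ‖θh j - β‖ ≤ inner ℝ (g j (θh j)) (β - θh j))
    (hO3 : ‖∑ j ∈ S, a j ^ 2 • g j (θh j)‖ ≤ lam * (ε * (∑ j ∈ S, a j ^ 2) / W1)) :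
    (∀ j ∈ S, θh j = β) ∧
    ‖β - θ0‖ ≤ ‖∑ j ∈ S, a j ^ 2 • g j (θs j)‖ / (ρ * ∑ j ∈ S, a j ^ 2)
      + κ * κw * δ / W1 + ε * lam / (ρ * W1) := by
  obtain ⟨r, hr, hr1, hr2⟩ := aux_scalar hlam hρ hρL hε hδ hκ hκw1 hκε hW1 hG0 hG hδL
  set W := ∑ j ∈ S, a j ^ 2 with hW
  have hWpos : 0 < W := Finset.sum_pos (fun j hj => pow_pos (ha j hj) 2) hS
  have hL : 0 < L := by linarith
  have hsa : ∑ j ∈ S, a j = κw * W / W1 := by rw [hκw]; field_simp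
  have hball : ∀ j ∈ S, ∀ x, ‖x - θ0‖ ≤ r → a j * ‖x - θs j‖ ≤ a j * r + δ := by
    intro j hj x hx
    have h1 : ‖x - θs j‖ ≤ ‖x - θ0‖ + ‖θs j - θ0‖ := by
      rw [show x - θs j = (x - θ0) - (θs j - θ0) by abel]; exact norm_sub_le _ _
    have h2 := mul_le_mul_of_nonneg_left (h1.trans (add_le_add_left hx _)) (ha j hj).le
    have := hθ0 j hj
    linarith
  have hW1r : ∀ j ∈ S, a j * r + δ ≤ W1 * r + δ := fun j hj => by
    have := mul_le_mul_of_nonneg_right (haW j hj) hr.le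
    linarith
  have hmem : ∀ j ∈ S, ∀ x, ‖x - θ0‖ ≤ r → x ∈ closedBall (θs j) M := by
    intro j hj x hx
    rw [mem_closedBall, dist_eq_norm]
    have h1 := (hball j hj x hx).trans (hW1r j hj)
    have h2 := mul_le_mul_of_nonneg_left h1 hL.le
    have h3 := hlamM j hj
    have h4 : ρ * (M * a j) ≤ L * (M * a j) :=
      mul_le_mul_of_nonneg_right hρL (mul_pos hM (ha j hj)).le
    have h6 : 0 < ρ * (M * a j) := mul_pos hρ (mul_pos hM (ha j hj))
    have h5 : L * (a j * ‖x - θs j‖) ≤ L * (a j * M) := by linarith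
    exact le_of_mul_le_mul_left (le_of_mul_le_mul_left h5 hL) (ha j hj)
  have hgx0 : ∀ j ∈ S, ∀ x, x ∈ closedBall (θs j) M →
      a j * ‖g j x‖ ≤ G + L * (a j * ‖x - θs j‖) := by
    intro j hj x hx
    have h1 : ‖g j x‖ ≤ ‖g j x - g j (θs j)‖ + ‖g j (θs j)‖ := by
      simpa using norm_add_le (g j x - g j (θs j)) (g j (θs j))
    have h2 := mul_le_mul_of_nonneg_left
      (h1.trans (add_le_add_left (hlip j hj x hx) _)) (ha j hj).le
    have := hgs j hj
    linarith
  have hgx : ∀ j ∈ S, ∀ x, ‖x - θ0‖ ≤ r → ‖g j x‖ < lam / a j := by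
    intro j hj x hx
    rw [lt_div_iff₀ (ha j hj)]
    have h1 := hgx0 j hj x (hmem j hj x hx)
    have h2 := mul_le_mul_of_nonneg_left ((hball j hj x hx).trans (hW1r j hj)) hL.le
    linarith
  have h00 : ‖θ0 - θ0‖ ≤ r := by simpa using hr.le
  have hsub : ∀ j ∈ S, ∀ x, ‖x - θ0‖ ≤ r →
      inner ℝ (g j x) (β - x) ≤ inner ℝ (g j (θh j)) (β - x) := by
    intro j hj x hx
    have h1 := hmono j hj (θh j) x
    have h2 := hO2 j hj
    have h3 : inner ℝ (g j x) (β - θh j) ≤ lam / a j * ‖θh j - β‖ := by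
      refine (real_inner_le_norm _ _).trans ?_
      rw [norm_sub_rev β]
      exact mul_le_mul_of_nonneg_right (hgx j hj x hx).le (norm_nonneg _)
    have e : β - x = (β - θh j) + (θh j - x) := by abel
    rw [inner_sub_left] at h1
    rw [e, inner_add_right, inner_add_right]
    linarith
  have hg0 : ‖∑ j ∈ S, a j ^ 2 • g j θ0‖ ≤ (G + L * δ) * ∑ j ∈ S, a j := by
    refine aux_sumnorm S a _ _ ha (fun j hj => ?_)
    have h1 := hgx0 j hj θ0 (hmem j hj θ0 h00)
    have h2 := hθ0 j hj
    rw [norm_sub_rev] at h2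
    have := mul_le_mul_of_nonneg_left h2 hL.le
    linarith
  have hg1 : ‖∑ j ∈ S, a j ^ 2 • (g j θ0 - g j (θs j))‖ ≤ (L * δ) * ∑ j ∈ S, a j := by
    refine aux_sumnorm S a _ _ ha (fun j hj => ?_)
    have h1 := mul_le_mul_of_nonneg_left (hlip j hj θ0 (hmem j hj θ0 h00)) (ha j hj).le
    have h2 := hθ0 j hj
    rw [norm_sub_rev] at h2
    have := mul_le_mul_of_nonneg_left h2 hL.le
    linarith
  have hsumin : ∀ (u : ι → E) (z : E), inner ℝ (∑ j ∈ S, a j ^ 2 • u j) z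
      = ∑ j ∈ S, a j ^ 2 * inner ℝ (u j) z := by
    intro u z
    rw [sum_inner]
    simp only [real_inner_smul_left]
  have hβ : ‖β - θ0‖ ≤ r := by
    by_contra hlt
    push Not at hlt
    set v := β - θ0 with hv
    have hD : 0 < ‖v‖ := hr.trans hlt
    set s := r / ‖v‖ with hs
    have hs0 : 0 < s := by positivity
    have hs1 : s < 1 := by rw [hs, div_lt_one hD]; exact hlt
    have hsD : s * ‖v‖ = r := by rw [hs]; field_simp
    set x := θ0 + s • v with hx
    have ex : x - θ0 = s • v := by rw [hx]; abel
    have eβ : β - x = (1 - s) • v := by rw [hx, hv]; module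
    have hxr : ‖x - θ0‖ ≤ r := by
      rw [ex, norm_smul, Real.norm_of_nonneg hs0.le, hsD]
    have k1 : ∀ j ∈ S, inner ℝ (g j x) v ≤ inner ℝ (g j (θh j)) v := by
      intro j hj
      have := hsub j hj x hxr
      rw [eβ, real_inner_smul_right, real_inner_smul_right] at this
      exact le_of_mul_le_mul_left this (by linarith)
    have k2 : ∀ j ∈ S, ρ * r * ‖v‖ ≤ inner ℝ (g j x) v - inner ℝ (g j θ0) v := by
      intro j hj
      have := hstrong j hj x (hmem j hj x hxr) θ0 (hmem j hj θ0 h00)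
      rw [ex, norm_smul, Real.norm_of_nonneg hs0.le, real_inner_smul_right, inner_sub_left] at this
      refine le_of_mul_le_mul_left ?_ hs0
      rw [← hsD]
      linarith
    have k3 : W * (ρ * r * ‖v‖) ≤ inner ℝ (∑ j ∈ S, a j ^ 2 • g j (θh j)) v
        - inner ℝ (∑ j ∈ S, a j ^ 2 • g j θ0) v := by
      rw [hsumin, hsumin, ← Finset.sum_sub_distrib, hW, Finset.sum_mul]
      refine Finset.sum_le_sum (fun j hj => ?_)
      rw [← mul_sub]
      refine mul_le_mul_of_nonneg_left ?_ (sq_nonneg _)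
      linarith [k1 j hj, k2 j hj]
    have k4 : inner ℝ (∑ j ∈ S, a j ^ 2 • g j (θh j)) v ≤ lam * (ε * W / W1) * ‖v‖ :=
      (real_inner_le_norm _ _).trans (mul_le_mul_of_nonneg_right hO3 (norm_nonneg _))
    have k5 : -inner ℝ (∑ j ∈ S, a j ^ 2 • g j θ0) v ≤ (G + L * δ) * (κw * W / W1) * ‖v‖ := by
      rw [← inner_neg_left]
      refine (real_inner_le_norm _ _).trans (mul_le_mul_of_nonneg_right ?_ (norm_nonneg _))
      rw [norm_neg, ← hsa]
      exact hg0
    have k6 : (ρ * r) * (W * ‖v‖) ≤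
        (lam * ε / W1 + κw * (G + L * δ) / W1) * (W * ‖v‖) := by
      have e : (lam * ε / W1 + κw * (G + L * δ) / W1) * (W * ‖v‖) =
        lam * (ε * W / W1) * ‖v‖ + (G + L * δ) * (κw * W / W1) * ‖v‖ := by ring
      rw [e]
      linarith
    have := le_of_mul_le_mul_right k6 (by positivity)
    linarith
  have hall : ∀ j ∈ S, θh j = β := by
    intro j hj
    by_contra hne
    have hp : 0 < ‖θh j - β‖ := norm_pos_iff.2 (sub_ne_zero.2 hne)
    have h1 := hmono j hj β (θh j)
    have h2 := hO2 j hj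
    have h3 : inner ℝ (g j β) (β - θh j) < lam / a j * ‖θh j - β‖ := by
      refine (real_inner_le_norm _ _).trans_lt ?_
      rw [norm_sub_rev β]
      exact mul_lt_mul_of_pos_right (hgx j hj β hβ) hp
    rw [inner_sub_left] at h1
    linarith
  refine ⟨hall, ?_⟩
  have hO3' : ‖∑ j ∈ S, a j ^ 2 • g j β‖ ≤ lam * (ε * W / W1) := by
    rw [Finset.sum_congr rfl (fun j hj => by rw [← hall j hj])]
    exact hO3
  set v := β - θ0 with hv
  have k2 : W * (ρ * ‖v‖ ^ 2) ≤ inner ℝ (∑ j ∈ S, a j ^ 2 • g j β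
      - ∑ j ∈ S, a j ^ 2 • g j θ0) v := by
    rw [inner_sub_left, hsumin, hsumin, ← Finset.sum_sub_distrib, hW, Finset.sum_mul]
    refine Finset.sum_le_sum (fun j hj => ?_)
    rw [← mul_sub, ← inner_sub_left]
    exact mul_le_mul_of_nonneg_left
      (hstrong j hj β (hmem j hj β hβ) θ0 (hmem j hj θ0 h00)) (sq_nonneg _)
  set Q := ‖∑ j ∈ S, a j ^ 2 • g j (θs j)‖ with hQ
  have k3 : ‖∑ j ∈ S, a j ^ 2 • g j β - ∑ j ∈ S, a j ^ 2 • g j θ0‖ ≤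
      lam * (ε * W / W1) + (L * δ * (κw * W / W1) + Q) := by
    refine (norm_sub_le _ _).trans (add_le_add hO3' ?_)
    have e : ∑ j ∈ S, a j ^ 2 • g j θ0 =
        ∑ j ∈ S, a j ^ 2 • (g j θ0 - g j (θs j)) + ∑ j ∈ S, a j ^ 2 • g j (θs j) := by
      rw [← Finset.sum_add_distrib]
      refine Finset.sum_congr rfl (fun j _ => ?_)
      module
    rw [e, ← hsa]
    exact (norm_add_le _ _).trans (add_le_add hg1 le_rfl)
  have e : Q / (ρ * W) + κ * κw * δ / W1 + ε * lam / (ρ * W1) =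
      (lam * (ε * W / W1) + (L * δ * (κw * W / W1) + Q)) / (ρ * W) := by
    rw [hκ]; field_simp; ring
  rw [e, le_div_iff₀ (by positivity)]
  by_cases hv0 : ‖v‖ = 0
  · rw [hv0, zero_mul]; positivity
  have hvp : 0 < ‖v‖ := lt_of_le_of_ne (norm_nonneg _) (Ne.symm hv0)
  refine le_of_mul_le_mul_right ?_ hvp
  have := (k2.trans (real_inner_le_norm _ _)).trans
    (mul_le_mul_of_nonneg_right k3 (norm_nonneg _))
  linarith

theorem aux_outside {E : Type*} [NormedAddCommGroup E] [InnerProductSpace ℝ E]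
    (g : E → E) (θs x : E) {M ρ : ℝ} (hM : 0 < M)
    (hmono : ∀ x y, 0 ≤ inner ℝ (g x - g y) (x - y))
    (hstrong : ∀ x ∈ closedBall θs M, ∀ y ∈ closedBall θs M,
      ρ * ‖x - y‖ ^ 2 ≤ inner ℝ (g x - g y) (x - y))
    (hg : ‖g θs‖ ≤ ρ * M / 2) (hx : ‖g x‖ < ρ * M / 2) : x ∈ closedBall θs M := by
  by_contra hlt
  rw [mem_closedBall, dist_eq_norm] at hlt
  push Not at hlt
  set v := x - θs with hv
  have hD : 0 < ‖v‖ := hM.trans hlt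
  set s := M / ‖v‖ with hs
  have hs0 : 0 < s := by positivity
  have hs1 : s < 1 := by rw [hs, div_lt_one hD]; exact hlt
  have hsD : s * ‖v‖ = M := by rw [hs]; field_simp
  set y := θs + s • v with hy
  have ey : y - θs = s • v := by rw [hy]; abel
  have ex : x - y = (1 - s) • v := by rw [hy, hv]; module
  have hyM : y ∈ closedBall θs M := by
    rw [mem_closedBall, dist_eq_norm, ey, norm_smul, Real.norm_of_nonneg hs0.le, hsD]
  have k1 := hmono x y
  rw [ex, real_inner_smul_right, inner_sub_left] at k1
  have k1' := nonneg_of_mul_nonneg_right k1 (by linarith)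
  have k2 := hstrong y hyM θs (mem_closedBall_self hM.le)
  rw [ey, norm_smul, Real.norm_of_nonneg hs0.le, real_inner_smul_right, inner_sub_left] at k2
  have k3 : ρ * M * ‖v‖ ≤ inner ℝ (g y) v - inner ℝ (g θs) v := by
    refine le_of_mul_le_mul_left ?_ hs0
    rw [← hsD]
    linarith
  have k4 : inner ℝ (g x) v ≤ ‖g x‖ * ‖v‖ := real_inner_le_norm _ _
  have k5 : - inner ℝ (g θs) v ≤ ‖g θs‖ * ‖v‖ := by
    rw [← inner_neg_left, ← norm_neg (g θs)]; exact real_inner_le_norm _ _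
  have k6 : ρ * M * ‖v‖ ≤ (‖g x‖ + ‖g θs‖) * ‖v‖ := by linarith
  have := le_of_mul_le_mul_right k6 hD
  linarith

/-- a one-block variation of a separable minimizer -/
theorem aux_single {m : ℕ} {E : Type*} (φ : Fin m → E → ℝ) (θh : Fin m → E)
    (h : ∀ θ : Fin m → E, ∑ j, φ j (θh j) ≤ ∑ j, φ j (θ j)) (j : Fin m) (y : E) :
    φ j (θh j) ≤ φ j y := by
  classical
  have := h (Function.update θh j y)
  rw [← Finset.add_sum_erase _ _ (Finset.mem_univ j),
    ← Finset.add_sum_erase (s := Finset.univ)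
      (f := fun i => φ i (Function.update θh j y i)) (h := Finset.mem_univ j)] at this
  have e : ∑ x ∈ Finset.univ.erase j, φ x (Function.update θh j y x)
      = ∑ x ∈ Finset.univ.erase j, φ x (θh x) := by
    refine Finset.sum_congr rfl (fun x hx => ?_)
    rw [Function.update_of_ne (Finset.ne_of_mem_erase hx)]
  rw [e, Function.update_self] at this
  linarith

theorem aux_O1 {E : Type*} [NormedAddCommGroup E] [InnerProductSpace ℝ E] [CompleteSpace E]
    {h : E → ℝ} {x b g : E} {c : ℝ} (hc : 0 ≤ c) (hg : HasGradientAt h g x)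
    (H : ∀ y, h x + c * ‖x - b‖ ≤ h y + c * ‖y - b‖) : ‖g‖ ≤ c := by
  have := aux_deriv (v := -g) (c := -(c * ‖g‖)) hg (fun t h0 _ => by
    have h1 := H (x + t • -g)
    have h2 : ‖x + t • -g - b‖ ≤ ‖x - b‖ + t * ‖g‖ := by
      rw [show x + t • -g - b = (x - b) + t • -g by abel]
      refine (norm_add_le _ _).trans ?_
      rw [norm_smul, norm_neg, Real.norm_of_nonneg h0]
    have h3 := mul_le_mul_of_nonneg_left h2 hc
    linarith)
  rw [inner_neg_right, real_inner_self_eq_norm_sq] at this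
  by_cases h0 : ‖g‖ = 0
  · rw [h0]; exact hc
  have hp : 0 < ‖g‖ := lt_of_le_of_ne (norm_nonneg _) (Ne.symm h0)
  refine le_of_mul_le_mul_right ?_ hp
  linarith

theorem aux_O2 {E : Type*} [NormedAddCommGroup E] [InnerProductSpace ℝ E] [CompleteSpace E]
    {h : E → ℝ} {x b g : E} {c : ℝ} (hg : HasGradientAt h g x)
    (H : ∀ y, h x + c * ‖x - b‖ ≤ h y + c * ‖y - b‖) :
    c * ‖x - b‖ ≤ inner ℝ g (b - x) := by
  refine aux_deriv hg (fun t h0 h1 => ?_)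
  have h2 := H (x + t • (b - x))
  have h3 : ‖x + t • (b - x) - b‖ = (1 - t) * ‖x - b‖ := by
    rw [show x + t • (b - x) - b = (1 - t) • (x - b) by module, norm_smul,
      Real.norm_of_nonneg (by linarith)]
  rw [h3] at h2
  linarith

theorem aux_O3 {ι E : Type*} [NormedAddCommGroup E] [InnerProductSpace ℝ E] [CompleteSpace E]
    (S : Finset ι) (w : ι → ℝ) (f : ι → E → ℝ) (g θh : ι → E) (c : ℝ) (hc : 0 ≤ c)
    (hg : ∀ j ∈ S, HasGradientAt (f j) (g j) (θh j))
    (H : ∀ v, ∑ j ∈ S, w j * f j (θh j) ≤ ∑ j ∈ S, w j * f j (θh j + v) + c * ‖v‖) :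
    ‖∑ j ∈ S, w j • g j‖ ≤ c := by
  have hgr : HasGradientAt (fun v => ∑ j ∈ S, w j * f j (θh j + v)) (∑ j ∈ S, w j • g j) 0 := by
    rw [hasGradientAt_iff_hasFDerivAt, map_sum]
    refine HasFDerivAt.fun_sum (fun j hj => ?_)
    have h1 : HasFDerivAt (f j) (InnerProductSpace.toDual ℝ E (g j)) (θh j + 0) := by
      rw [add_zero]; exact (hg j hj).hasFDerivAt
    have h2 := (h1.comp (0:E) ((hasFDerivAt_id (0:E)).const_add (θh j))).const_mul (w j)
    rw [map_smul]
    exact h2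
  refine aux_O1 (b := 0) hc hgr (fun y => ?_)
  have := H y
  simpa using this

theorem aux_final {d m : ℕ}
    (f : Fin m → EE d → ℝ) (w : Fin m → ℝ) (θs : Fin m → EE d)
    (M ρ L ε δ lam κ κw wmax : ℝ) (S : Finset (Fin m)) (hS : S.Nonempty)
    (hw : ∀ j, 0 < w j) (hM : 0 < M) (hρ : 0 < ρ) (hρL : ρ ≤ L) (hε : 0 ≤ ε) (hδ : 0 ≤ δ)
    (hreg : ∀ j ∈ S, ARMULRegular (f j) (θs j) M ρ L)
    (hθ0 : ∃ θ0, ∀ j ∈ S, Real.sqrt (w j) * ‖θs j - θ0‖ ≤ δ)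
    (hmax : IsGreatest ((fun j => Real.sqrt (w j)) '' (S : Set (Fin m))) wmax)
    (hSc : (∑ j ∈ Sᶜ, Real.sqrt (w j)) ≤ ε * (∑ j ∈ S, w j) / wmax)
    (hκ : κ = L / ρ)
    (hκw : κw = wmax * (∑ j ∈ S, Real.sqrt (w j)) / (∑ j ∈ S, w j))
    (hκε : κ * ε < 1)
    (hlam1 : ∀ j ∈ S,
        5 * κ * κw / (1 - κ * ε) * (Real.sqrt (w j) * ‖gradient (f j) (θs j)‖) < lam)
    (hlam2 : ∀ j ∈ S, lam < ρ * M / 2 * Real.sqrt (w j))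
    (θhat : Fin m → EE d) (βhat : EE d)
    (hopt : ∀ (θ : Fin m → EE d) (β : EE d),
          ∑ j, w j * (f j (θhat j) + lam / Real.sqrt (w j) * ‖θhat j - βhat‖) ≤
          ∑ j, w j * (f j (θ j) + lam / Real.sqrt (w j) * ‖θ j - β‖)) :
    (∀ j ∈ S,
          ‖θhat j - θs j‖ ≤
            ‖∑ k ∈ S, w k • gradient (f k) (θs k)‖ / (ρ * ∑ k ∈ S, w k) +
            6 / ((1 - κ * ε) * Real.sqrt (w j)) *
              min (3 * κ ^ 2 * κw * δ) (2 * lam / (5 * ρ)) +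
            ε * lam / (ρ * wmax)) ∧
    (κ * κw * L * δ ≤ 2 / 15 * ((1 - κ * ε) * lam) → ∀ j ∈ S, θhat j = βhat) := by
  set a : Fin m → ℝ := fun j => Real.sqrt (w j) with ha_def
  have ha : ∀ j, 0 < a j := fun j => Real.sqrt_pos.2 (hw j)
  have haw : ∀ j, w j = a j ^ 2 := fun j => (Real.sq_sqrt (hw j).le).symm
  have haW : ∀ j ∈ S, a j ≤ wmax := fun j hj => hmax.2 ⟨j, hj, rfl⟩
  have hsw : ∑ j ∈ S, w j = ∑ j ∈ S, a j ^ 2 := Finset.sum_congr rfl (fun j _ => haw j)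
  have hWpos : 0 < ∑ j ∈ S, w j := Finset.sum_pos (fun j _ => hw j) hS
  obtain ⟨j0, hj0⟩ := hS
  have hW1 : 0 < wmax := (ha j0).trans_le (haW j0 hj0)
  have hκ1 : 1 ≤ κ := by rw [hκ, le_div_iff₀ hρ]; linarith
  have hLe : L = κ * ρ := by rw [hκ]; field_simp
  have hL : 0 < L := by linarith
  have hκw1 : 1 ≤ κw := by
    rw [hκw, le_div_iff₀ hWpos, one_mul, hsw, Finset.mul_sum]
    refine Finset.sum_le_sum (fun j hj => ?_)
    rw [sq]
    exact mul_le_mul_of_nonneg_right (haW j hj) (ha j).le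
  have hq : 0 < 1 - κ * ε := by linarith
  have hlam : 0 < lam := lt_of_le_of_lt
    (mul_nonneg (by positivity) (mul_nonneg (ha j0).le (norm_nonneg _))) (hlam1 j0 hj0)
  have hdiff : ∀ j ∈ S, Differentiable ℝ (f j) := fun j hj =>
    (hreg j hj).2.1.differentiable (by norm_num)
  have hmono : ∀ j ∈ S, ∀ x y,
      0 ≤ inner ℝ (gradient (f j) x - gradient (f j) y) (x - y) := fun j hj x y =>
    aux_mono_s6 (hdiff j hj) (hreg j hj).1 x y
  have hstrong : ∀ j ∈ S, ∀ x ∈ closedBall (θs j) M, ∀ y ∈ closedBall (θs j) M,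
      ρ * ‖x - y‖ ^ 2 ≤ inner ℝ (gradient (f j) x - gradient (f j) y) (x - y) :=
    fun j hj x hx y hy => aux_strong_s6 (hreg j hj) hx hy
  have hlip : ∀ j ∈ S, ∀ x ∈ closedBall (θs j) M,
      ‖gradient (f j) x - gradient (f j) (θs j)‖ ≤ L * ‖x - θs j‖ :=
    fun j hj x hx => aux_lip hρ hρL (hreg j hj) hx (mem_closedBall_self hM.le)
  -- optimality
  have hblock : ∀ j y, f j (θhat j) + lam / a j * ‖θhat j - βhat‖ ≤
      f j y + lam / a j * ‖y - βhat‖ := by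
    intro j y
    have := aux_single (fun j z => w j * (f j z + lam / a j * ‖z - βhat‖)) θhat
      (fun θ => hopt θ βhat) j y
    exact le_of_mul_le_mul_left this (hw j)
  have hO1 : ∀ j ∈ S, ‖gradient (f j) (θhat j)‖ ≤ lam / a j := fun j hj =>
    aux_O1 (div_pos hlam (ha j)).le (hdiff j hj _).hasGradientAt (hblock j)
  have hO2 : ∀ j ∈ S, lam / a j * ‖θhat j - βhat‖ ≤
      inner ℝ (gradient (f j) (θhat j)) (βhat - θhat j) := fun j hj =>
    aux_O2 (hdiff j hj _).hasGradientAt (hblock j)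
  have hO3 : ‖∑ j ∈ S, a j ^ 2 • gradient (f j) (θhat j)‖ ≤ lam * ∑ j ∈ Sᶜ, a j := by
    refine aux_O3 S (fun j => a j ^ 2) f _ θhat _
      (mul_nonneg hlam.le (Finset.sum_nonneg (fun j _ => (ha j).le)))
      (fun j hj => (hdiff j hj _).hasGradientAt) (fun v => ?_)
    have h1 := hopt (fun j => if j ∈ S then θhat j + v else θhat j) (βhat + v)
    rw [← Finset.sum_add_sum_compl S, ← Finset.sum_add_sum_compl S] at h1
    have e1 : ∀ j ∈ S, w j * (f j (if j ∈ S then θhat j + v else θhat j) +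
        lam / a j * ‖(if j ∈ S then θhat j + v else θhat j) - (βhat + v)‖) =
        a j ^ 2 * f j (θhat j + v) + w j * (lam / a j * ‖θhat j - βhat‖) := by
      intro j hj
      rw [if_pos hj, add_sub_add_right_eq_sub, ← haw]; ring
    have e2 : ∀ j ∈ Sᶜ, w j * (f j (if j ∈ S then θhat j + v else θhat j) +
        lam / a j * ‖(if j ∈ S then θhat j + v else θhat j) - (βhat + v)‖) ≤
        w j * (f j (θhat j) + lam / a j * ‖θhat j - βhat‖) + lam * a j * ‖v‖ := by
      intro j hj
      rw [if_neg (Finset.mem_compl.1 hj)]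
      have h2 : ‖θhat j - (βhat + v)‖ ≤ ‖θhat j - βhat‖ + ‖v‖ := by
        rw [← sub_sub]; exact norm_sub_le _ _
      have e3 : lam * a j * ‖v‖ = w j * (lam / a j * ‖v‖) := by
        have := (ha j).ne'
        rw [haw]; field_simp
      rw [e3, ← mul_add, add_assoc, ← mul_add]
      refine mul_le_mul_of_nonneg_left ?_ (hw j).le
      have := mul_le_mul_of_nonneg_left h2 (div_pos hlam (ha j)).le
      linarith
    have e0 : ∑ j ∈ S, w j * (f j (θhat j) + lam / a j * ‖θhat j - βhat‖) =
        ∑ j ∈ S, a j ^ 2 * f j (θhat j) + ∑ j ∈ S, w j * (lam / a j * ‖θhat j - βhat‖) := by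
      rw [← Finset.sum_add_distrib]
      refine Finset.sum_congr rfl (fun j _ => ?_)
      rw [← haw]; ring
    have h3 := Finset.sum_le_sum e2
    rw [Finset.sum_add_distrib, ← Finset.sum_mul, ← Finset.mul_sum] at h3
    have h4 := Finset.sum_congr rfl e1
    rw [Finset.sum_add_distrib] at h4
    linarith
  have hO3' : ‖∑ j ∈ S, a j ^ 2 • gradient (f j) (θhat j)‖
      ≤ lam * (ε * (∑ j ∈ S, a j ^ 2) / wmax) := by
    refine hO3.trans (mul_le_mul_of_nonneg_left ?_ hlam.le)
    rw [← hsw]; exact hSc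
  set G := (1 - κ * ε) * lam / (5 * κ * κw) with hGdef
  have hG0 : 0 ≤ G := by positivity
  have hG : 5 * κ * κw * G ≤ (1 - κ * ε) * lam := by rw [hGdef]; apply le_of_eq; field_simp
  have hgs : ∀ j ∈ S, a j * ‖gradient (f j) (θs j)‖ ≤ G := by
    intro j hj
    have := (hlam1 j hj).le
    rw [hGdef, le_div_iff₀ (by positivity)]
    rw [div_mul_eq_mul_div, div_le_iff₀ hq] at this
    linarith
  have hG5 : G ≤ lam / 5 := by
    have h1 : (1 - κ * ε) * lam ≤ lam := by
      have : 0 ≤ κ * ε * lam := by positivity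
      linarith
    have h2 : 5 * G ≤ 5 * κ * κw * G := by
      have : 1 ≤ κ * κw := one_le_mul_of_one_le_of_one_le hκ1 hκw1
      have := mul_le_mul_of_nonneg_right this hG0
      linarith
    linarith
  have hcrude : ∀ j ∈ S, ‖θhat j - θs j‖ ≤ 6 * lam / (5 * ρ * a j) := by
    intro j hj
    have hin : θhat j ∈ closedBall (θs j) M := by
      refine aux_outside (gradient (f j)) _ _ hM (hmono j hj) (hstrong j hj) (hreg j hj).2.2.2 ?_
      refine (hO1 j hj).trans_lt ?_
      rw [div_lt_iff₀ (ha j)]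
      exact hlam2 j hj
    have h1 := hstrong j hj _ hin _ (mem_closedBall_self hM.le)
    have h2 := h1.trans (real_inner_le_norm _ _)
    have h3 : ρ * ‖θhat j - θs j‖ ≤ ‖gradient (f j) (θhat j) - gradient (f j) (θs j)‖ := by
      by_cases h0 : ‖θhat j - θs j‖ = 0
      · rw [h0, mul_zero]; positivity
      have hp : 0 < ‖θhat j - θs j‖ := lt_of_le_of_ne (norm_nonneg _) (Ne.symm h0)
      refine le_of_mul_le_mul_right ?_ hp
      linarith
    have h4 := h3.trans (norm_sub_le _ _)
    have h5 := hO1 j hj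
    have h6 := hgs j hj
    rw [le_div_iff₀ (ha j)] at h5
    have := ha j
    rw [le_div_iff₀ (by positivity)]
    have h7 := mul_le_mul_of_nonneg_right h4 (ha j).le
    linarith
  obtain ⟨θ0, hθ0⟩ := hθ0
  have hcore : κ * κw * L * δ ≤ 2 / 15 * ((1 - κ * ε) * lam) → _ := fun hδL =>
    aux_core S ⟨j0, hj0⟩ (fun j => gradient (f j)) a θs θhat θ0 βhat hM (fun j _ => ha j) haW
      hmono hstrong hlip hlam hρ hρL hε hδ hκ hκw1 (by rw [hκw, hsw]) hκε hW1 hG0 hG hδL hgs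
      hθ0 hlam2 hO2 hO3'
  refine ⟨?_, fun h => (hcore h).1⟩
  intro j hj
  have haj := ha j
  have hT1 : 0 ≤ ‖∑ k ∈ S, w k • gradient (f k) (θs k)‖ / (ρ * ∑ k ∈ S, w k) := by positivity
  have hT3 : 0 ≤ ε * lam / (ρ * wmax) := by positivity
  have hq1 : 1 - κ * ε ≤ 1 := by
    have : 0 ≤ κ * ε := by positivity
    linarith
  have hc2 : 6 * lam / (5 * ρ * a j) ≤ 6 / ((1 - κ * ε) * a j) * (2 * lam / (5 * ρ)) := by
    rw [div_mul_div_comm, div_le_div_iff₀ (by positivity) (by positivity)]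
    have : 0 < lam * ρ * a j := by positivity
    have := mul_le_mul_of_nonneg_right hq1 this.le
    linarith
  rw [mul_min_of_nonneg _ _ (by positivity)]
  by_cases hδL : κ * κw * L * δ ≤ 2 / 15 * ((1 - κ * ε) * lam)
  · rcases min_choice (6 / ((1 - κ * ε) * a j) * (3 * κ ^ 2 * κw * δ))
      (6 / ((1 - κ * ε) * a j) * (2 * lam / (5 * ρ))) with h | h
    · rw [h]
      obtain ⟨h1, h2⟩ := hcore hδL
      have e : ∑ k ∈ S, w k • gradient (f k) (θs k) =
          ∑ k ∈ S, a k ^ 2 • gradient (f k) (θs k) :=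
        Finset.sum_congr rfl (fun k _ => by rw [haw k])
      rw [e, hsw, h1 j hj]
      have h3 : ‖βhat - θs j‖ ≤ ‖βhat - θ0‖ + ‖θs j - θ0‖ := by
        rw [show βhat - θs j = (βhat - θ0) - (θs j - θ0) by abel]; exact norm_sub_le _ _
      have h4 : ‖θs j - θ0‖ ≤ δ / a j := by
        rw [le_div_iff₀ haj, mul_comm]; exact hθ0 j hj
      have h5 : κ * κw * δ / wmax ≤ κ * κw * δ / a j :=
        div_le_div_of_nonneg_left (by positivity) haj (haW j hj)
      have hkk : 1 ≤ κ * κw := one_le_mul_of_one_le_of_one_le hκ1 hκw1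
      have h6 : δ / a j ≤ κ * κw * δ / a j := by
        refine div_le_div_of_nonneg_right ?_ haj.le
        exact le_mul_of_one_le_left hδ hkk
      have h7 : 2 * (κ * κw * δ / a j) ≤ 6 / ((1 - κ * ε) * a j) * (3 * κ ^ 2 * κw * δ) := by
        rw [← mul_div_assoc, div_mul_eq_mul_div, div_le_div_iff₀ haj (by positivity)]
        have p1 : 0 ≤ κ * κw * δ * a j := by positivity
        have p2 := mul_le_mul_of_nonneg_right hq1 p1
        have p3 := mul_le_mul_of_nonneg_right hκ1 p1
        linarith
      linarith
    · rw [h]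
      linarith [hcrude j hj]
  · push Not at hδL
    have hc1 : 6 * lam / (5 * ρ * a j) ≤ 6 / ((1 - κ * ε) * a j) * (3 * κ ^ 2 * κw * δ) := by
      rw [div_mul_eq_mul_div, div_le_div_iff₀ (by positivity) (by positivity)]
      rw [hLe] at hδL
      have p0 : 0 ≤ (1 - κ * ε) * lam * a j := by positivity
      have p1 := mul_le_mul_of_nonneg_right hδL.le haj.le
      linarith
    have := le_min hc1 hc2
    linarith [hcrude j hj]

/-- Adaptivity and robustness of vanilla ARMUL (deterministic version). -/
theorem stmt_6 : ∃ C > (0 : ℝ),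
    ∀ (d m : ℕ), 1 ≤ d → 1 ≤ m →
    ∀ (f : Fin m → EuclideanSpace ℝ (Fin d) → ℝ) (w : Fin m → ℝ)
      (θs : Fin m → EuclideanSpace ℝ (Fin d))
      (M ρ L ε δ lam κ κw wmax : ℝ) (S : Finset (Fin m)) (hS : S.Nonempty),
      (∀ j, ConvexOn ℝ Set.univ (f j)) →
      (∀ j, 0 < w j) → 0 < M → 0 < ρ → ρ ≤ L → 0 ≤ ε → 0 ≤ δ →
      (∀ j ∈ S, ARMULRegular (f j) (θs j) M ρ L) →
      (∃ θ0, ∀ j ∈ S, Real.sqrt (w j) * ‖θs j - θ0‖ ≤ δ) →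
      IsGreatest ((fun j => Real.sqrt (w j)) '' (S : Set (Fin m))) wmax →
      (∑ j ∈ Sᶜ, Real.sqrt (w j)) ≤ ε * (∑ j ∈ S, w j) / wmax →
      κ = L / ρ →
      κw = wmax * (∑ j ∈ S, Real.sqrt (w j)) / (∑ j ∈ S, w j) →
      κ * ε < 1 →
      (∀ j ∈ S,
        5 * κ * κw / (1 - κ * ε) * (Real.sqrt (w j) * ‖gradient (f j) (θs j)‖) < lam) →
      (∀ j ∈ S, lam < ρ * M / 2 * Real.sqrt (w j)) →
      ∀ (θhat : Fin m → EuclideanSpace ℝ (Fin d)) (βhat : EuclideanSpace ℝ (Fin d)),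
        (∀ (θ : Fin m → EuclideanSpace ℝ (Fin d)) (β : EuclideanSpace ℝ (Fin d)),
          ∑ j, w j * (f j (θhat j) + lam / Real.sqrt (w j) * ‖θhat j - βhat‖) ≤
          ∑ j, w j * (f j (θ j) + lam / Real.sqrt (w j) * ‖θ j - β‖)) →
        (∀ j ∈ S,
          ‖θhat j - θs j‖ ≤
            ‖∑ k ∈ S, w k • gradient (f k) (θs k)‖ / (ρ * ∑ k ∈ S, w k) +
            6 / ((1 - κ * ε) * Real.sqrt (w j)) *
              min (3 * κ ^ 2 * κw * δ) (2 * lam / (5 * ρ)) +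
            ε * lam / (ρ * wmax)) ∧
        ((ε = 0 ∧ C * κ * κw * L * δ < lam) →
          (∀ j k, θhat j = θhat k) ∧
          ∀ j, ∀ θ, ∑ k, w k * f k (θhat j) ≤ ∑ k, w k * f k θ) := by
  refine ⟨15 / 2, by norm_num, ?_⟩
  intro d m _ hm f w θs M ρ L ε δ lam κ κw wmax S hS hconv hw hM hρ hρL hε hδ hreg hθ0 hmax hSc
    hκ hκw hκε hlam1 hlam2 θhat βhat hopt
  obtain ⟨h1, h2⟩ := aux_final f w θs M ρ L ε δ lam κ κw wmax S hS hw hM hρ hρL hε hδ hreg hθ0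
    hmax hSc hκ hκw hκε hlam1 hlam2 θhat βhat hopt
  refine ⟨h1, ?_⟩
  rintro ⟨hε0, hC⟩
  have hall : ∀ j ∈ S, θhat j = βhat := by
    refine h2 ?_
    rw [hε0]
    linarith
  have hmem : ∀ j, j ∈ S := by
    intro j
    by_contra hj
    have h3 : 0 < ∑ j ∈ Sᶜ, Real.sqrt (w j) :=
      Finset.sum_pos (fun j _ => Real.sqrt_pos.2 (hw j)) ⟨j, Finset.mem_compl.2 hj⟩
    rw [hε0, zero_mul, zero_div] at hSc
    linarith
  have hall' : ∀ j, θhat j = βhat := fun j => hall j (hmem j)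
  refine ⟨fun j k => by rw [hall', hall'], fun j θ => ?_⟩
  have h4 := hopt (fun _ => θ) θ
  simp only [hall', sub_self, norm_zero, mul_zero, add_zero] at h4
  rw [hall']
  exact h4
end

section
/- Let d, m ≥ 1, K ≥ 2 and α ∈ (0, 1]. Let f_1,…,f_m : ℝ^d → ℝ be convex differentiable functions, θ*_1,…,θ*_m ∈ ℝ^d, β*_1,…,β*_K ∈ ℝ^d, z*_1,…,z*_m ∈ {1,…,K}, M > 0, 0 < ρ ≤ L < ∞, ε ≥ 0, δ ≥ 0, and S ⊆ {1,…,m} with |S^c| ≤ ε·m such that for each j ∈ S, f_j is (θ*_j, M, ρ, L)-regular and ‖θ*_j − β*_{z*_j}‖₂ ≤ δ. Set κ = L/ρ and T(k) = {j : z*_j = k}. Suppose ε ≤ α/(6κK²), min_k |T(k)| ≥ 7αm/(6K), and (12κK/√α)·max_{j∈[m]} ‖∇f_j(θ*_j)‖₂ < λ < (ρ/6)·min{ M, min_{k≠l} ‖β*_k − β*_l‖₂ }. Then every minimizer (θ̂_1,…,θ̂_m, β̂_1,…,β̂_K, ẑ) of Σ_{j=1}^m [ f_j(θ_j) + λ‖β_{z_j}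 − θ_j‖₂ ] over θ_j ∈ ℝ^d, β_k ∈ ℝ^d and z ∈ {1,…,K}^m subject to min_k |{j : z_j = k}| ≥ αm/K satisfies, for all j ∈ S, ‖θ̂_j − θ*_j‖₂ ≤ ‖Σ_{i∈T(z*_j)∩S} ∇f_i(θ*_i)‖₂/(ρ·|T(z*_j)∩S|) + min{ 55κ²Kδ/√α, 11λ/(5ρ) } + λ·|S^c|/(ρ·|T(z*_j)∩S|). Moreover, if δ ≤ √α·λ/(100κKL), then there exists a permutation τ of {1,…,K} such that ẑ_j = τ(z*_j) and θ̂_j = β̂_{ẑ_j} for all j ∈ S. -/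
open Metric Finset

lemma fd_grad {d : ℕ} {f : EuclideanSpace ℝ (Fin d) → ℝ} {x : EuclideanSpace ℝ (Fin d)}
    (h : DifferentiableAt ℝ f x) (v : EuclideanSpace ℝ (Fin d)) :
    fderiv ℝ f x v = inner ℝ (gradient f x) v := by
  have := h.hasGradientAt.hasFDerivAt.fderiv
  rw [this]; simp

lemma taylor_reg {d : ℕ} {f : EuclideanSpace ℝ (Fin d) → ℝ}
    {θs : EuclideanSpace ℝ (Fin d)} {M ρ L : ℝ} (h : ARMULRegular f θs M ρ L)
    {x y : EuclideanSpace ℝ (Fin d)} (hx : ‖x - θs‖ ≤ M) (hy : ‖y - θs‖ ≤ M) :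
    f x + inner ℝ (gradient f x) (y - x) + ρ / 2 * ‖y - x‖ ^ 2 ≤ f y ∧
    f y ≤ f x + inner ℝ (gradient f x) (y - x) + L / 2 * ‖y - x‖ ^ 2 := by
  obtain ⟨-, hC, hH, -⟩ := h
  set v := y - x with hv
  have hline : ∀ t : ℝ, HasDerivAt (fun t : ℝ => x + t • v) v t := by
    intro t
    simpa using ((hasDerivAt_id t).smul_const v).const_add x
  have hd1 : Differentiable ℝ f := hC.differentiable (by norm_num)
  have hd2 : Differentiable ℝ (fderiv ℝ f) :=
    (hC.fderiv_right (m := 1) (by norm_num)).differentiable (by norm_num)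
  have h1 : ∀ t : ℝ, HasDerivAt (fun t : ℝ => f (x + t • v)) (fderiv ℝ f (x + t • v) v) t := by
    intro t
    exact (hd1 (x + t • v)).hasFDerivAt.comp_hasDerivAt t (hline t)
  have h2 : ∀ t : ℝ, HasDerivAt (fun t : ℝ => fderiv ℝ f (x + t • v) v)
      (hessQ f (x + t • v) v) t := by
    intro t
    have := (hd2 (x + t • v)).hasFDerivAt.comp_hasDerivAt t (hline t)
    have h3 := this.clm_apply (hasDerivAt_const t v)
    simpa [hessQ, iteratedFDeriv_two_apply] using h3
  have hball : ∀ t ∈ Set.Icc (0:ℝ) 1, x + t • v ∈ closedBall θs M := by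
    intro t ht
    have hc := convex_closedBall θs M
    have hxm : x ∈ closedBall θs M := by simpa [dist_eq_norm] using hx
    have hym : y ∈ closedBall θs M := by simpa [dist_eq_norm] using hy
    exact hc.add_smul_sub_mem hxm hym ht
  -- generic comparison
  have gen : ∀ φ φ' : ℝ → ℝ, (∀ t, HasDerivAt φ (φ' t) t) →
      (∀ t ∈ Set.Icc (0:ℝ) 1, 0 ≤ φ' t) → ∀ t ∈ Set.Icc (0:ℝ) 1, φ 0 ≤ φ t := by
    intro φ φ' hφ hpos t ht
    have hm : MonotoneOn φ (Set.Icc 0 1) := by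
      apply monotoneOn_of_deriv_nonneg (convex_Icc 0 1)
      · exact fun s _ => (hφ s).continuousAt.continuousWithinAt
      · exact fun s _ => (hφ s).differentiableAt.differentiableWithinAt
      · intro s hs
        rw [(hφ s).deriv]
        rw [interior_Icc] at hs
        exact hpos s ⟨hs.1.le, hs.2.le⟩
    exact hm ⟨le_rfl, zero_le_one⟩ ht ht.1
  have hone : (1:ℝ) ∈ Set.Icc (0:ℝ) 1 := ⟨zero_le_one, le_rfl⟩
  have hg : fderiv ℝ f x v = inner ℝ (gradient f x) v := fd_grad (hd1 x) v
  have hy' : x + (1:ℝ) • v = y := by simp [hv]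
  have hlin : ∀ c t : ℝ, HasDerivAt (fun t : ℝ => c * t) c t := by
    intro c t
    simpa using (hasDerivAt_id t).const_mul c
  have hquad : ∀ c t : ℝ, HasDerivAt (fun t : ℝ => c / 2 * t ^ 2) (c * t) t := by
    intro c t
    have := (hasDerivAt_pow 2 t).const_mul (c / 2)
    refine this.congr_deriv ?_
    norm_num
    ring
  constructor
  · have a1 : ∀ t ∈ Set.Icc (0:ℝ) 1,
        0 ≤ fderiv ℝ f (x + t • v) v - fderiv ℝ f x v - ρ * ‖v‖ ^ 2 * t := by
      intro t ht
      have := gen (fun t => fderiv ℝ f (x + t • v) v - ρ * ‖v‖ ^ 2 * t) _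
        (fun t => (h2 t).sub (hlin (ρ * ‖v‖ ^ 2) t))
        (fun t ht => by linarith [(hH _ (hball t ht) v).1]) t ht
      simp only [zero_smul, add_zero, mul_zero, sub_zero] at this
      linarith
    have := gen (fun t => f (x + t • v) - fderiv ℝ f x v * t - ρ * ‖v‖ ^ 2 / 2 * t ^ 2) _
        (fun t => ((h1 t).sub (hlin (fderiv ℝ f x v) t)).sub (hquad (ρ * ‖v‖ ^ 2) t))
        a1 1 hone
    rw [hy'] at this
    simp only [zero_smul, add_zero] at this
    rw [← hg]
    nlinarith [this]
  · have a1 : ∀ t ∈ Set.Icc (0:ℝ) 1,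
        0 ≤ L * ‖v‖ ^ 2 * t - (fderiv ℝ f (x + t • v) v - fderiv ℝ f x v) := by
      intro t ht
      have := gen (fun t => L * ‖v‖ ^ 2 * t - fderiv ℝ f (x + t • v) v) _
        (fun t => (hlin (L * ‖v‖ ^ 2) t).sub (h2 t))
        (fun t ht => by linarith [(hH _ (hball t ht) v).2]) t ht
      simp only [zero_smul, add_zero, mul_zero, zero_sub] at this
      linarith
    have := gen (fun t => L * ‖v‖ ^ 2 / 2 * t ^ 2 - (f (x + t • v) - fderiv ℝ f x v * t)) _
        (fun t => (hquad (L * ‖v‖ ^ 2) t).sub ((h1 t).sub (hlin (fderiv ℝ f x v) t)))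
        a1 1 hone
    rw [hy'] at this
    simp only [zero_smul, add_zero] at this
    rw [← hg]
    nlinarith [this]

/-- first-order convexity -/
lemma convex_grad {d : ℕ} {f : EuclideanSpace ℝ (Fin d) → ℝ} (hc : ConvexOn ℝ Set.univ f)
    (hd : Differentiable ℝ f) (x y : EuclideanSpace ℝ (Fin d)) :
    f x + inner ℝ (gradient f x) (y - x) ≤ f y := by
  have hcl : ConvexOn ℝ Set.univ (fun t : ℝ => f (x + t • (y - x))) := by
    have := hc.comp_affineMap (AffineMap.lineMap (k := ℝ) x y)
    refine this.congr ?_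
    intro t _
    simp [AffineMap.lineMap_apply, add_comm]
  have hdl : HasDerivAt (fun t : ℝ => f (x + t • (y - x))) (fderiv ℝ f x (y - x)) 0 := by
    have hl : HasDerivAt (fun t : ℝ => x + t • (y - x)) (y - x) 0 := by
      simpa using ((hasDerivAt_id (0:ℝ)).smul_const (y - x)).const_add x
    have h0 : HasFDerivAt f (fderiv ℝ f x) (x + (0:ℝ) • (y - x)) := by
      simpa using (hd x).hasFDerivAt
    exact h0.comp_hasDerivAt (0:ℝ) hl
  have := hcl.le_slope_of_hasDerivAt (Set.mem_univ 0) (Set.mem_univ 1) zero_lt_one hdl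
  rw [slope_def_field] at this
  simp at this
  rw [← fd_grad (hd x)]
  simp only [map_sub]
  linarith

/-- a vector whose inner products are controlled has controlled norm -/
lemma grad_lip {d : ℕ} {f : EuclideanSpace ℝ (Fin d) → ℝ}
    {θs : EuclideanSpace ℝ (Fin d)} {M ρ L : ℝ} (h : ARMULRegular f θs M ρ L) 
    {x : EuclideanSpace ℝ (Fin d)} (hx : ‖x - θs‖ ≤ M) :
    ‖gradient f x - gradient f θs‖ ≤ L * ‖x - θs‖ := by
  have hM : 0 ≤ M := (norm_nonneg _).trans hx
  have hd1 : Differentiable ℝ f := h.2.1.differentiable (by norm_num)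
  have h0 : ‖θs - θs‖ ≤ M := by simpa using hM
  set r := ‖x - θs‖ with hr
  set p := gradient f x - gradient f θs with hp
  rcases eq_or_ne p 0 with h1 | h1
  · rw [h1]
    rcases eq_or_ne r 0 with h2 | h2
    · simp [h2]
    · have t := (taylor_reg h h0 hx)
      have t1 := convex_grad h.1 hd1 θs x
      have hrpos : 0 < r := lt_of_le_of_ne (norm_nonneg _) (Ne.symm h2)
      have : 0 ≤ L / 2 * r ^ 2 := by linarith [t.2]
      have : 0 ≤ L / 2 := by
        by_contra hcon
        push Not at hcon
        nlinarith [pow_pos hrpos 2]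
      rw [norm_zero]
      nlinarith
  rcases eq_or_ne r 0 with h2 | h2
  · exfalso
    have : x = θs := by rwa [hr, norm_eq_zero, sub_eq_zero] at h2
    apply h1; rw [hp, this, sub_self]
  have hrpos : 0 < r := lt_of_le_of_ne (norm_nonneg _) (Ne.symm h2)
  have hppos : 0 < ‖p‖ := norm_pos_iff.mpr h1
  set w := (r / ‖p‖) • p with hw
  have hwn : ‖w‖ = r := by
    rw [hw, norm_smul, Real.norm_of_nonneg (by positivity)]
    field_simp
  have hwin : inner ℝ p w = r * ‖p‖ := by
    rw [hw, inner_smul_right, real_inner_self_eq_norm_sq]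
    field_simp
  have e1 := (taylor_reg h h0 (y := θs + w) (by simpa [hwn] using hx)).2
  have e2 := convex_grad h.1 hd1 x (θs + w)
  have e3 := (taylor_reg h hx h0).2
  rw [add_sub_cancel_left, hwn] at e1
  rw [norm_sub_rev, ← hr] at e3
  have e4 : inner ℝ (gradient f x) (θs + w - x) =
      inner ℝ (gradient f x) w - inner ℝ (gradient f x) (x - θs) := by
    rw [← inner_sub_right]; congr 1; abel
  have e7 : inner ℝ (gradient f x) (θs - x) = - inner ℝ (gradient f x) (x - θs) := by
    rw [← inner_neg_right]; congr 1; abel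
  have e8 : inner ℝ p w = inner ℝ (gradient f x) w - inner ℝ (gradient f θs) w := by
    rw [hp, inner_sub_left]
  have : r * ‖p‖ ≤ r * (L * r) := by nlinarith
  exact le_of_mul_le_mul_left this hrpos

/-- quadratic upper bound at the center -/
lemma up_bound {d : ℕ} {f : EuclideanSpace ℝ (Fin d) → ℝ}
    {θs : EuclideanSpace ℝ (Fin d)} {M ρ L G : ℝ} (h : ARMULRegular f θs M ρ L)
    (hG : ‖gradient f θs‖ ≤ G) {x : EuclideanSpace ℝ (Fin d)} (hx : ‖x - θs‖ ≤ M) :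
    f x ≤ f θs + G * ‖x - θs‖ + L / 2 * ‖x - θs‖ ^ 2 := by
  have hM : 0 ≤ M := (norm_nonneg _).trans hx
  have t := (taylor_reg h (x := θs) (by simpa using hM) hx).2
  have := real_inner_le_norm (gradient f θs) (x - θs)
  nlinarith [norm_nonneg (x - θs)]

/-- strict optimality at points with small gradient -/
lemma strict_opt {d : ℕ} {f : EuclideanSpace ℝ (Fin d) → ℝ}
    {θs : EuclideanSpace ℝ (Fin d)} {M ρ L G lam : ℝ} (h : ARMULRegular f θs M ρ L)
    (hG : ‖gradient f θs‖ ≤ G) {x θ : EuclideanSpace ℝ (Fin d)} (hx : ‖x - θs‖ ≤ M)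
    (hl : G + L * ‖x - θs‖ < lam) (hne : θ ≠ x) : f x < f θ + lam * ‖x - θ‖ := by
  have hd1 : Differentiable ℝ f := h.2.1.differentiable (by norm_num)
  have t := convex_grad h.1 hd1 x θ
  have h1 := grad_lip h hx
  have h2 : ‖gradient f x‖ < lam := by
    have : ‖gradient f x‖ ≤ ‖gradient f x - gradient f θs‖ + ‖gradient f θs‖ := by
      simpa using norm_add_le (gradient f x - gradient f θs) (gradient f θs)
    linarith
  have h3 := neg_le_of_abs_le (abs_real_inner_le_norm (gradient f x) (θ - x))
  have h4 : 0 < ‖x - θ‖ := norm_pos_iff.mpr (sub_ne_zero.mpr hne.symm)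
  rw [norm_sub_rev θ x] at h3
  nlinarith

/-- lower growth: inside and outside the ball -/
lemma growth {d : ℕ} {f : EuclideanSpace ℝ (Fin d) → ℝ}
    {θs : EuclideanSpace ℝ (Fin d)} {M ρ L G : ℝ} (hM : 0 < M) (h : ARMULRegular f θs M ρ L)
    (hG : ‖gradient f θs‖ ≤ G) (θ : EuclideanSpace ℝ (Fin d)) :
    f θs - G * ‖θ - θs‖ + ρ / 2 * ‖θ - θs‖ * min ‖θ - θs‖ M ≤ f θ := by
  have key : ∀ x, ‖x - θs‖ ≤ M → f θs - G * ‖x - θs‖ + ρ / 2 * ‖x - θs‖ ^ 2 ≤ f x := by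
    intro x hx
    have t := (taylor_reg h (x := θs) (by simpa using hM.le) hx).1
    have h3 := neg_le_of_abs_le (abs_real_inner_le_norm (gradient f θs) (x - θs))
    nlinarith [norm_nonneg (x - θs)]
  rcases le_total ‖θ - θs‖ M with h1 | h1
  · rw [min_eq_left h1]
    have := key θ h1
    nlinarith
  · rw [min_eq_right h1]
    set r := ‖θ - θs‖ with hr
    have hrpos : 0 < r := lt_of_lt_of_le hM h1
    set t := M / r with ht
    have ht0 : 0 ≤ t := by positivity
    have ht1 : t ≤ 1 := by rw [ht, div_le_one hrpos]; exact h1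
    have htr : t * r = M := by rw [ht]; field_simp
    have hxn : ‖(1 - t) • θs + t • θ - θs‖ = M := by
      have : (1 - t) • θs + t • θ - θs = t • (θ - θs) := by module
      rw [this, norm_smul, Real.norm_of_nonneg ht0, ← hr, htr]
    have k := key ((1 - t) • θs + t • θ) hxn.le
    rw [hxn] at k
    have c := h.1.2 (Set.mem_univ θs) (Set.mem_univ θ) (sub_nonneg.mpr ht1) ht0 (by ring)
    simp only [smul_eq_mul] at c
    have : t * (f θs - G * r + ρ / 2 * r * M) ≤ t * f θ := by
      have e1 : t * (f θs - G * r + ρ / 2 * r * M) = t * f θs - G * M + ρ / 2 * M ^ 2 := by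
        rw [← htr]; ring
      rw [e1]; linarith
    exact le_of_mul_le_mul_left this (by positivity)

/-- Huber-type lower bound in its linear form. -/
lemma low_bound {d : ℕ} {f : EuclideanSpace ℝ (Fin d) → ℝ}
    {θs : EuclideanSpace ℝ (Fin d)} {M ρ L G lam s : ℝ} (hM : 0 < M) (hρ : 0 < ρ)
    (h : ARMULRegular f θs M ρ L) (hG : ‖gradient f θs‖ ≤ G)
    (hGl : G + lam ≤ ρ / 2 * M) (hs0 : 0 ≤ s) (hsl : s ≤ lam)
    (θ β : EuclideanSpace ℝ (Fin d)) :
    f θs - G ^ 2 / (2 * ρ) + s * (‖β - θs‖ - G / ρ) - s ^ 2 / (2 * ρ)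
      ≤ f θ + lam * ‖β - θ‖ := by
  have g := growth hM h hG θ
  have hG0 : 0 ≤ G := (norm_nonneg _).trans hG
  have tri : ‖β - θs‖ ≤ ‖β - θ‖ + ‖θ - θs‖ := by
    simpa using norm_add_le (β - θ) (θ - θs)
  set r := ‖θ - θs‖ with hr
  have hr0 : 0 ≤ r := norm_nonneg _
  have e0 : s * (‖β - θs‖ - r) ≤ lam * ‖β - θ‖ := by
    nlinarith [norm_nonneg (β - θ)]
  have e1 : -(G ^ 2 / (2 * ρ)) - s * (G / ρ) - s ^ 2 / (2 * ρ) = -((G + s) ^ 2 / (2 * ρ)) := by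
    field_simp; ring
  have e2 : -((G + s) ^ 2 / (2 * ρ)) ≤ -(G + s) * r + ρ / 2 * r * min r M := by
    rcases le_total r M with h1 | h1
    · rw [min_eq_left h1]
      have : -(G + s) * r + ρ / 2 * r * r + (G + s) ^ 2 / (2 * ρ)
          = (ρ * r - (G + s)) ^ 2 / (2 * ρ) := by field_simp; ring
      have h2 : 0 ≤ (ρ * r - (G + s)) ^ 2 / (2 * ρ) := by positivity
      linarith
    · rw [min_eq_right h1]
      have h2 : 0 ≤ (G + s) ^ 2 / (2 * ρ) := by positivity
      have h3 : 0 ≤ r * (ρ / 2 * M - (G + s)) := mul_nonneg hr0 (by linarith)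
      nlinarith
  nlinarith

/-- crude bound on the individual minimizer -/
lemma crude {d : ℕ} {f : EuclideanSpace ℝ (Fin d) → ℝ}
    {θs : EuclideanSpace ℝ (Fin d)} {M ρ L G lam : ℝ} (hM : 0 < M) (hρ : 0 < ρ)
    (h : ARMULRegular f θs M ρ L) (hG : ‖gradient f θs‖ ≤ G)
    (hGl : G + lam < ρ / 2 * M) (θ : EuclideanSpace ℝ (Fin d))
    (hopt : f θ ≤ f θs + lam * ‖θ - θs‖) (hl : 0 ≤ lam) : ‖θ - θs‖ ≤ 2 * (lam + G) / ρ := by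
  have g := growth hM h hG θ
  have hG0 : 0 ≤ G := (norm_nonneg _).trans hG
  set r := ‖θ - θs‖ with hr
  rcases (norm_nonneg _ : 0 ≤ r).eq_or_lt with h0 | h0
  · rw [hr, ← h0]; positivity
  have h1 : r * (ρ / 2 * min r M) ≤ r * (lam + G) := by nlinarith
  have h2 := le_of_mul_le_mul_left h1 h0
  rcases le_total r M with h3 | h3
  · rw [min_eq_left h3] at h2
    rw [le_div_iff₀ hρ]; linarith
  · rw [min_eq_right h3] at h2
    linarith

/-- splitting the comparison over `S` and its complement -/
lemma split_cmp {m : ℕ} (S : Finset (Fin m)) (c c' : Fin m → ℝ) (B : ℝ)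
    (h : ∑ j, c j ≤ ∑ j, c' j) (hB : ∀ j, j ∉ S → c' j ≤ c j + B) :
    ∑ j ∈ S, c j ≤ ∑ j ∈ S, c' j + ((Sᶜ : Finset (Fin m)).card : ℝ) * B := by
  rw [← Finset.sum_add_sum_compl S c, ← Finset.sum_add_sum_compl S c'] at h
  have : ∑ j ∈ Sᶜ, c' j ≤ ∑ j ∈ Sᶜ, (c j + B) :=
    Finset.sum_le_sum fun j hj => hB j (by simpa using hj)
  rw [Finset.sum_add_distrib, Finset.sum_const, nsmul_eq_mul] at this
  linarith

set_option maxHeartbeats 2000000 in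
lemma cluster {d m K : ℕ} (hK : 0 < K)
    {f : Fin m → EuclideanSpace ℝ (Fin d) → ℝ}
    {θs : Fin m → EuclideanSpace ℝ (Fin d)} {βs : Fin K → EuclideanSpace ℝ (Fin d)}
    {zs : Fin m → Fin K} {M ρ L δ lam κ G N : ℝ} {S : Finset (Fin m)}
    (hM : 0 < M) (hρ : 0 < ρ) (hκ1 : 1 ≤ κ) (hL : L = κ * ρ) (hδ : 0 ≤ δ) (hlam : 0 < lam)
    (hN : 0 < N) (hG0 : 0 ≤ G) (hG : G ≤ lam / (24 * κ)) (hδ2 : δ ≤ lam / (50 * L))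
    (hE : m * (G ^ 2 / (2 * ρ) + G * δ + L / 2 * δ ^ 2) ≤ N * lam ^ 2 / (250 * κ ^ 2 * ρ))
    (hSc : ((Sᶜ : Finset (Fin m)).card : ℝ) ≤ N / (12 * κ))
    (hreg : ∀ j ∈ S, ARMULRegular (f j) (θs j) M ρ L)
    (hgrad : ∀ j ∈ S, ‖gradient (f j) (θs j)‖ ≤ G)
    (hclose : ∀ j ∈ S, ‖θs j - βs (zs j)‖ ≤ δ)
    (hbal : ∀ k : Fin K, N ≤ (((Finset.univ.filter fun j => zs j = k) ∩ S).card : ℝ))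
    (hlam2 : 6 * (lam / ρ) < M)
    (hlam3 : ∀ k l : Fin K, k ≠ l → 6 * (lam / ρ) < ‖βs k - βs l‖)
    {θhat : Fin m → EuclideanSpace ℝ (Fin d)} {βhat : Fin K → EuclideanSpace ℝ (Fin d)}
    {zhat : Fin m → Fin K}
    (hcard : ∀ k : Fin K, N ≤ ((Finset.univ.filter fun j => zhat j = k).card : ℝ))
    (hmin : ∀ (θ : Fin m → EuclideanSpace ℝ (Fin d))
        (β : Fin K → EuclideanSpace ℝ (Fin d)) (z : Fin m → Fin K),
      (∀ k : Fin K, N ≤ ((Finset.univ.filter fun j => z j = k).card : ℝ)) →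
      ∑ j, (f j (θhat j) + lam * ‖βhat (zhat j) - θhat j‖) ≤
      ∑ j, (f j (θ j) + lam * ‖β (z j) - θ j‖)) :
    ∃ τ : Equiv.Perm (Fin K), ∀ j ∈ S, zhat j = τ (zs j) ∧ θhat j = βhat (zhat j) ∧
      ‖βhat (zhat j) - θs j‖ ≤ lam / (2 * L) := by
  have : Nonempty (Fin K) := ⟨⟨0, hK⟩⟩
  have hLpos : 0 < L := by rw [hL]; positivity
  have hκ0 : 0 < κ := by linarith
  -- scales
  obtain ⟨w, hw⟩ : ∃ w, w = lam / L := ⟨_, rfl⟩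
  obtain ⟨a, ha⟩ : ∃ a, a = lam / ρ := ⟨_, rfl⟩
  have hLw : L * w = lam := by rw [hw]; field_simp
  have hρa : ρ * a = lam := by rw [ha]; field_simp
  have hκw : κ * w = a := by rw [hw, ha, hL]; field_simp
  have hw0 : 0 < w := by rw [hw]; positivity
  have ha0 : 0 < a := by rw [ha]; positivity
  have hwa : w ≤ a := by nlinarith
  have hδw : δ ≤ w / 50 := by
    refine hδ2.trans (le_of_eq ?_); rw [hw]; field_simp
  have hGρ : G / ρ ≤ w / 24 := by
    rw [div_le_iff₀ hρ]; refine hG.trans (le_of_eq ?_); rw [hw, hL]; field_simp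
  have hGlam : G ≤ lam / 24 := by
    refine hG.trans ?_
    apply div_le_div_of_nonneg_left hlam.le (by norm_num); linarith
  rw [← ha] at hlam2
  simp only [← ha] at hlam3
  have hGM : G + lam < ρ / 2 * M := by nlinarith
  have hG2 : G ^ 2 / (2 * ρ) ≤ lam * a / 2 := by
    have : G ^ 2 / (2 * ρ) = G * (G / ρ) / 2 := by field_simp
    rw [this]
    have : G * (G / ρ) ≤ lam * a := by
      apply mul_le_mul <;> first | linarith | positivity
    linarith
  -- nearest centers
  have hnear : ∀ k : Fin K, ∃ l : Fin K, ∀ l' : Fin K, ‖βhat k - βs l‖ ≤ ‖βhat k - βs l'‖ :=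
    fun k => Finite.exists_min fun l => ‖βhat k - βs l‖
  choose σ hσ using hnear
  obtain ⟨k0, hk0⟩ := Finite.exists_max fun k => ‖βhat k - βs (σ k)‖
  obtain ⟨D, hD⟩ : ∃ D, D = ‖βhat k0 - βs (σ k0)‖ := ⟨_, rfl⟩
  have hD0 : 0 ≤ D := by rw [hD]; exact norm_nonneg _
  have hDk : ∀ k, ‖βhat k - βs (σ k)‖ ≤ D := by rw [hD]; exact hk0
  -- excess
  obtain ⟨e, he⟩ : ∃ e : Fin m → ℝ, ∀ j, e j =
    f j (θhat j) + lam * ‖βhat (zhat j) - θhat j‖ - f j (θs j) + G ^ 2 / (2 * ρ) :=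
    ⟨_, fun _ => rfl⟩
  have elow : ∀ j ∈ S, ∀ s, 0 ≤ s → s ≤ lam →
      s * (‖βhat (zhat j) - θs j‖ - G / ρ) - s ^ 2 / (2 * ρ) ≤ e j := by
    intro j hj s hs0 hsl
    have := low_bound hM hρ (hreg j hj) (hgrad j hj) hGM.le hs0 hsl (θhat j) (βhat (zhat j))
    rw [he]; linarith
  have epos : ∀ j ∈ S, 0 ≤ e j := by
    intro j hj
    have := elow j hj 0 le_rfl hlam.le
    simpa using this
  have hSm : (S.card : ℝ) ≤ m := by
    have := Finset.card_le_univ S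
    rw [Fintype.card_fin] at this
    exact_mod_cast this
  have hScD : ((Sᶜ : Finset (Fin m)).card : ℝ) * (lam * D) ≤ N * w * D * ρ / 12 := by
    have h1 : N / (12 * κ) * (lam * D) = N * w * D * ρ / 12 := by
      rw [hw, hL]; field_simp
    rw [← h1]
    exact mul_le_mul_of_nonneg_right hSc (by positivity)
  have hEm : m * (G ^ 2 / (2 * ρ) + G * δ + L / 2 * δ ^ 2) ≤ N * w ^ 2 * ρ / 250 := by
    refine hE.trans (le_of_eq ?_); rw [hw, hL]; field_simp
  have I1 : ∑ j ∈ S, e j ≤ N * w ^ 2 * ρ / 250 + N * w * D * ρ / 12 := by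
    have h1 := hmin (fun j => if j ∈ S then βs (zs j) else θhat j) βs
      (fun j => if j ∈ S then zs j else σ (zhat j)) (by
        intro k
        refine (hbal k).trans ?_
        exact_mod_cast Finset.card_le_card (by
          intro j hj
          simp only [Finset.mem_inter, Finset.mem_filter, Finset.mem_univ, true_and] at hj ⊢
          rw [if_pos hj.2]; exact hj.1))
    have h2 := split_cmp S _ _ (lam * D) h1 (by
      intro j hj
      simp only [if_neg hj]
      have : ‖βs (σ (zhat j)) - θhat j‖ ≤ ‖βhat (zhat j) - θhat j‖ + D := by
        have t := norm_add_le (βs (σ (zhat j)) - βhat (zhat j)) (βhat (zhat j) - θhat j)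
        rw [sub_add_sub_cancel, norm_sub_rev (βs _) (βhat _)] at t
        linarith [hDk (zhat j)]
      nlinarith)
    have h3 : ∑ j ∈ S, (f j (if j ∈ S then βs (zs j) else θhat j) +
        lam * ‖βs (if j ∈ S then zs j else σ (zhat j)) - (if j ∈ S then βs (zs j) else θhat j)‖)
        ≤ ∑ j ∈ S, (f j (θs j) + (G * δ + L / 2 * δ ^ 2)) := by
      apply Finset.sum_le_sum
      intro j hj
      simp only [if_pos hj, sub_self, norm_zero, mul_zero, add_zero]
      have hc := hclose j hj
      rw [norm_sub_rev] at hc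
      have := up_bound (hreg j hj) (hgrad j hj) (x := βs (zs j)) (by linarith)
      have hn := norm_nonneg (βs (zs j) - θs j)
      have h5 : L / 2 * ‖βs (zs j) - θs j‖ ^ 2 ≤ L / 2 * δ ^ 2 := by gcongr
      have h6 : G * ‖βs (zs j) - θs j‖ ≤ G * δ := by gcongr
      linarith
    have h4 : ∑ j ∈ S, e j = ∑ j ∈ S, (f j (θhat j) + lam * ‖βhat (zhat j) - θhat j‖)
        - ∑ j ∈ S, f j (θs j) + S.card * (G ^ 2 / (2 * ρ)) := by
      simp only [he]
      rw [Finset.sum_add_distrib, Finset.sum_sub_distrib, Finset.sum_const, nsmul_eq_mul]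
    have h5 : ∑ j ∈ S, (f j (θs j) + (G * δ + L / 2 * δ ^ 2)) =
        ∑ j ∈ S, f j (θs j) + S.card * (G * δ + L / 2 * δ ^ 2) := by
      rw [Finset.sum_add_distrib, Finset.sum_const, nsmul_eq_mul]
    rw [h5] at h3
    have h6 : (S.card : ℝ) * (G ^ 2 / (2 * ρ) + G * δ + L / 2 * δ ^ 2) ≤
        m * (G ^ 2 / (2 * ρ) + G * δ + L / 2 * δ ^ 2) :=
      mul_le_mul_of_nonneg_right hSm (by positivity)
    rw [h4]
    linarith
  -- lower bound of total via subsets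
  have sub : ∀ (A : Finset (Fin m)) (c : ℝ), A ⊆ S → (∀ j ∈ A, c ≤ e j) →
      (A.card : ℝ) * c ≤ N * w ^ 2 * ρ / 250 + N * w * D * ρ / 12 := by
    intro A c hA hc
    have h1 : ∑ j ∈ A, c ≤ ∑ j ∈ A, e j := Finset.sum_le_sum hc
    have h2 : ∑ j ∈ A, e j ≤ ∑ j ∈ S, e j :=
      Finset.sum_le_sum_of_subset_of_nonneg hA fun j hj _ => epos j hj
    rw [Finset.sum_const, nsmul_eq_mul] at h1
    linarith
  -- I2
  have hDw : D ≤ 2 / 5 * w := by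
    by_contra hcon
    push Not at hcon
    have hA := sub ((Finset.univ.filter fun j => zhat j = k0) ∩ S)
      (w * ρ / 2 * (D - w / 50 - w / 24) - w ^ 2 * ρ / 8) Finset.inter_subset_right (by
        intro j hj
        simp only [Finset.mem_inter, Finset.mem_filter, Finset.mem_univ, true_and] at hj
        have h1 := elow j hj.2 (w * ρ / 2) (by positivity) (by nlinarith)
        have h2 : (w * ρ / 2) ^ 2 / (2 * ρ) = w ^ 2 * ρ / 8 := by field_simp; norm_num
        rw [h2] at h1
        have h3 : D - w / 50 - w / 24 ≤ ‖βhat (zhat j) - θs j‖ - G / ρ := by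
          have t1 := hσ k0 (zs j)
          have t := norm_add_le (βhat (zhat j) - θs j) (θs j - βs (zs j))
          rw [sub_add_sub_cancel] at t
          rw [hj.1] at t ⊢
          linarith [hclose j hj.2]
        have h4 : w * ρ / 2 * (D - w / 50 - w / 24) ≤
          w * ρ / 2 * (‖βhat (zhat j) - θs j‖ - G / ρ) :=
          mul_le_mul_of_nonneg_left h3 (by positivity)
        linarith)
    have hAc : 11 / 12 * N ≤ (((Finset.univ.filter fun j => zhat j = k0) ∩ S).card : ℝ) := by
      have h1 := hcard k0
      have h2 : (Finset.univ.filter fun j => zhat j = k0).card ≤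
          ((Finset.univ.filter fun j => zhat j = k0) ∩ S).card + (Sᶜ).card := by
        rw [← Finset.card_inter_add_card_sdiff _ S]
        gcongr
        intro j hj
        simp only [Finset.mem_sdiff] at hj
        simpa using hj.2
      have h3 : ((Finset.univ.filter fun j => zhat j = k0).card : ℝ) ≤
          (((Finset.univ.filter fun j => zhat j = k0) ∩ S).card : ℝ)
            + ((Sᶜ : Finset (Fin m)).card : ℝ) := by exact_mod_cast h2
      have h4 : N / (12 * κ) ≤ N / 12 := by
        apply div_le_div_of_nonneg_left hN.le (by norm_num); linarith
      linarith
    have hfac : 0 ≤ w * ρ / 2 * (D - w / 50 - w / 24) - w ^ 2 * ρ / 8 := by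
      have : w * ρ / 2 * (D - w / 50 - w / 24) - w ^ 2 * ρ / 8 =
        w * ρ * ((D - w / 50 - w / 24) / 2 - w / 8) := by ring
      rw [this]
      apply mul_nonneg (by positivity); linarith
    have h5 := (mul_le_mul_of_nonneg_right hAc hfac).trans hA
    have h6 : (N * w * ρ) * (11 / 12 * ((D - w / 50 - w / 24) / 2 - w / 8)) ≤
        (N * w * ρ) * (w / 250 + D / 12) := by linarith
    have h7 := le_of_mul_le_mul_left h6 (by positivity)
    linarith
  have hmis : ∀ j ∈ S, σ (zhat j) ≠ zs j → 4 * (lam * a) ≤ e j := by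
    intro j hj hne
    have h1 := elow j hj lam hlam.le le_rfl
    have h2 := hlam3 _ _ hne
    have h3 : 5 * a ≤ ‖βhat (zhat j) - θs j‖ - G / ρ := by
      have t1 := norm_sub_le_norm_sub_add_norm_sub (βs (σ (zhat j))) (βhat (zhat j)) (βs (zs j))
      have t2 := norm_sub_le_norm_sub_add_norm_sub (βhat (zhat j)) (θs j) (βs (zs j))
      rw [norm_sub_rev (βs _) (βhat _)] at t1
      linarith [hDk (zhat j), hclose j hj]
    have h4 : lam ^ 2 / (2 * ρ) = lam * a / 2 := by rw [ha]; field_simp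
    rw [h4] at h1
    have := mul_le_mul_of_nonneg_left h3 hlam.le
    have : 0 < lam * a := by positivity
    nlinarith
  have hsurj : Function.Surjective σ := by
    intro l
    by_contra hcon
    push Not at hcon
    have hA := sub ((Finset.univ.filter fun j => zs j = l) ∩ S) (4 * (lam * a))
      Finset.inter_subset_right (by
        intro j hj
        simp only [Finset.mem_inter, Finset.mem_filter, Finset.mem_univ, true_and] at hj
        refine hmis j hj.2 ?_
        rw [hj.1]; exact hcon _)
    have h1 : N * (4 * (lam * a)) ≤ N * w ^ 2 * ρ / 250 + N * w * D * ρ / 12 :=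
      (mul_le_mul_of_nonneg_right (hbal l) (by positivity)).trans hA
    have h2 : N * (4 * (lam * a)) ≤ N * (w * ρ * (w / 250 + D / 12)) := by linarith
    have h3 := le_of_mul_le_mul_left h2 hN
    have h4 : w * ρ * (w / 250 + D / 12) ≤ lam * a := by
      apply mul_le_mul
      · nlinarith
      · linarith
      · positivity
      · positivity
    have : 0 < lam * a := by positivity
    linarith
  have hbij : Function.Bijective σ := Finite.surjective_iff_bijective.mp hsurj
  obtain ⟨τ, hτ⟩ : ∃ τ : Equiv.Perm (Fin K), ∀ l, σ (τ l) = l :=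
    ⟨(Equiv.ofBijective σ hbij).symm, fun l => (Equiv.ofBijective σ hbij).apply_symm_apply l⟩
  have hbclose : ∀ j ∈ S, ‖βhat (τ (zs j)) - θs j‖ ≤ 21 / 50 * w := by
    intro j hj
    have h1 := hDk (τ (zs j))
    rw [hτ] at h1
    have t := norm_sub_le_norm_sub_add_norm_sub (βhat (τ (zs j))) (βs (zs j)) (θs j)
    have := hclose j hj
    rw [norm_sub_rev] at this
    linarith
  have hterm : ∀ j ∈ S, f j (βhat (τ (zs j))) ≤ f j (θhat j) + lam * ‖βhat (zhat j) - θhat j‖ ∧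
      (f j (θhat j) + lam * ‖βhat (zhat j) - θhat j‖ ≤ f j (βhat (τ (zs j))) →
        zhat j = τ (zs j) ∧ θhat j = βhat (zhat j)) := by
    intro j hj
    have hb := hbclose j hj
    have hbM : ‖βhat (τ (zs j)) - θs j‖ ≤ M := by linarith
    by_cases hz : zhat j = τ (zs j)
    · have h1 : θhat j ≠ βhat (τ (zs j)) →
          f j (βhat (τ (zs j))) < f j (θhat j) + lam * ‖βhat (τ (zs j)) - θhat j‖ := by
        refine strict_opt (hreg j hj) (hgrad j hj) hbM ?_
        have := mul_le_mul_of_nonneg_left hb hLpos.le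
        nlinarith
      rw [hz]
      by_cases h2 : θhat j = βhat (τ (zs j))
      · rw [h2]; simp
      · have h3 := h1 h2
        exact ⟨h3.le, fun h4 => absurd h4 (not_le.mpr h3)⟩
    · have hne : σ (zhat j) ≠ zs j := by
        intro h1
        apply hz
        apply hbij.1
        rw [h1, hτ]
      have h1 := hmis j hj hne
      have h2 := up_bound (hreg j hj) (hgrad j hj) hbM
      rw [he] at h1
      have hn := norm_nonneg (βhat (τ (zs j)) - θs j)
      have h3 : G * ‖βhat (τ (zs j)) - θs j‖ ≤ lam * a := by
        apply mul_le_mul <;> linarith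
      have h4 : L / 2 * ‖βhat (τ (zs j)) - θs j‖ ^ 2 ≤ lam * a := by
        have : ‖βhat (τ (zs j)) - θs j‖ ^ 2 ≤ w * a := by
          rw [sq]; apply mul_le_mul <;> linarith
        have h5 : L * (w * a) = lam * a := by rw [← mul_assoc, hLw]
        have h6 := mul_le_mul_of_nonneg_left this hLpos.le
        have : 0 ≤ L * ‖βhat (τ (zs j)) - θs j‖ ^ 2 := by positivity
        linarith
      have h5 : 0 < lam * a := by positivity
      have h6 : f j (βhat (τ (zs j))) < f j (θhat j) + lam * ‖βhat (zhat j) - θhat j‖ := by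
        linarith
      exact ⟨h6.le, fun h4 => absurd h4 (not_le.mpr h6)⟩
  have I4 : ∑ j ∈ S, (f j (θhat j) + lam * ‖βhat (zhat j) - θhat j‖) ≤
      ∑ j ∈ S, f j (βhat (τ (zs j))) := by
    have h1 := hmin (fun j => if j ∈ S then βhat (τ (zs j)) else θhat j) βhat
      (fun j => if j ∈ S then τ (zs j) else zhat j) (by
        intro k
        refine (hbal (τ.symm k)).trans ?_
        exact_mod_cast Finset.card_le_card (by
          intro j hj
          simp only [Finset.mem_inter, Finset.mem_filter, Finset.mem_univ, true_and] at hj ⊢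
          rw [if_pos hj.2, hj.1]; simp))
    have h2 := split_cmp S _ _ 0 h1 (by
      intro j hj
      simp only [if_neg hj, add_zero]; exact le_rfl)
    rw [mul_zero, add_zero] at h2
    refine h2.trans (le_of_eq ?_)
    apply Finset.sum_congr rfl
    intro j hj
    simp [if_pos hj]
  have heq := (Finset.sum_eq_sum_iff_of_le fun j hj => (hterm j hj).1).mp
    (le_antisymm (Finset.sum_le_sum fun j hj => (hterm j hj).1) I4)
  refine ⟨τ, fun j hj => ?_⟩
  have h1 := (hterm j hj).2 (heq j hj).ge
  refine ⟨h1.1, h1.2, ?_⟩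
  have h2 := hbclose j hj
  rw [h1.1]
  have h3 : lam / (2 * L) = w / 2 := by rw [hw]; field_simp
  linarith

lemma first_order {d : ℕ} {g : EuclideanSpace ℝ (Fin d) → ℝ}
    {g' : EuclideanSpace ℝ (Fin d) →L[ℝ] ℝ} {b : EuclideanSpace ℝ (Fin d)} {c : ℝ}
    (hg : HasFDerivAt g g' b) (hopt : ∀ b', g b ≤ g b' + c * ‖b' - b‖)
    (v : EuclideanSpace ℝ (Fin d)) : -(c * ‖v‖) ≤ g' v := by
  have hl : HasDerivAt (fun t : ℝ => b + t • v) v 0 := by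
    simpa using ((hasDerivAt_id (0:ℝ)).smul_const v).const_add b
  have h0 : HasFDerivAt g g' (b + (0:ℝ) • v) := by simpa using hg
  have hd := h0.comp_hasDerivAt (0:ℝ) hl
  have hs := hd.tendsto_slope_zero_right
  refine ge_of_tendsto hs ?_
  filter_upwards [self_mem_nhdsWithin] with t ht
  have ht : 0 < t := ht
  have h1 := hopt (b + t • v)
  rw [add_sub_cancel_left, norm_smul, Real.norm_of_nonneg ht.le] at h1
  simp only [Function.comp, zero_add, zero_smul, add_zero, smul_eq_mul]
  rw [inv_mul_eq_div, le_div_iff₀ ht]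
  linarith

lemma refine_bound {d m : ℕ} {f : Fin m → EuclideanSpace ℝ (Fin d) → ℝ}
    {θs : Fin m → EuclideanSpace ℝ (Fin d)} {M ρ L δ c : ℝ} (A : Finset (Fin m))
    (hA : 0 < (A.card : ℝ)) (hρ : 0 < ρ) (hL : 0 < L)
    (hreg : ∀ i ∈ A, ARMULRegular (f i) (θs i) M ρ L)
    (b p : EuclideanSpace ℝ (Fin d))
    (hb : ∀ i ∈ A, ‖b - θs i‖ ≤ M) (hp : ∀ i ∈ A, ‖p - θs i‖ ≤ M)
    (hpδ : ∀ i ∈ A, ‖p - θs i‖ ≤ 2 * δ)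
    (hopt : ∀ b', ∑ i ∈ A, f i b ≤ ∑ i ∈ A, f i b' + c * ‖b' - b‖) (hc : 0 ≤ c) (hδ : 0 ≤ δ) :
    ‖b - p‖ ≤ ‖∑ i ∈ A, gradient (f i) (θs i)‖ / (ρ * A.card) + 2 * (L / ρ) * δ
      + c / (ρ * A.card) := by
  have hdif : ∀ i ∈ A, Differentiable ℝ (f i) := fun i hi =>
    (hreg i hi).2.1.differentiable (by norm_num)
  have hfo := first_order (g := fun x => ∑ i ∈ A, f i x) (g' := ∑ i ∈ A, fderiv ℝ (f i) b)
    (b := b) (c := c)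
    (HasFDerivAt.fun_sum fun i hi => (hdif i hi b).hasFDerivAt) hopt (p - b)
  rw [_root_.sum_apply] at hfo
  set r := ‖b - p‖ with hr
  rw [norm_sub_rev, ← hr] at hfo
  have hr0 : 0 ≤ r := norm_nonneg _
  -- strong monotonicity, summed
  have h1 : ∀ i ∈ A, fderiv ℝ (f i) b (p - b) + inner ℝ (gradient (f i) (θs i)) (b - p)
      - L * (2 * δ) * r + ρ * r ^ 2 ≤ 0 := by
    intro i hi
    have t1 := (taylor_reg (hreg i hi) (hb i hi) (hp i hi)).1
    have t2 := (taylor_reg (hreg i hi) (hp i hi) (hb i hi)).1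
    rw [norm_sub_rev, ← hr] at t1
    rw [← hr] at t2
    rw [fd_grad (hdif i hi b)]
    have t3 := (grad_lip (hreg i hi) (hp i hi)).trans
      (mul_le_mul_of_nonneg_left (hpδ i hi) hL.le)
    have t4 := neg_le_of_abs_le
      (abs_real_inner_le_norm (gradient (f i) p - gradient (f i) (θs i)) (b - p))
    rw [inner_sub_left, ← hr] at t4
    have t5 := mul_le_mul_of_nonneg_right t3 hr0
    linarith
  have h2 := Finset.sum_le_sum h1
  simp only [Finset.sum_add_distrib, Finset.sum_sub_distrib, Finset.sum_const, nsmul_eq_mul,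
    ← sum_inner, mul_zero] at h2
  have h3 := neg_le_of_abs_le
      (abs_real_inner_le_norm (∑ i ∈ A, gradient (f i) (θs i)) (b - p))
  rw [← hr] at h3
  rcases hr0.eq_or_lt with h0 | h0
  · rw [← h0]; positivity
  have h4 : r * (ρ * A.card * r) ≤
      r * (‖∑ i ∈ A, gradient (f i) (θs i)‖ + A.card * (L * (2 * δ)) + c) := by nlinarith
  have h5 := le_of_mul_le_mul_left h4 h0
  have h6 : ‖∑ i ∈ A, gradient (f i) (θs i)‖ / (ρ * A.card) + 2 * (L / ρ) * δ
      + c / (ρ * A.card) =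
      (‖∑ i ∈ A, gradient (f i) (θs i)‖ + A.card * (L * (2 * δ)) + c) / (ρ * A.card) := by
    field_simp
  rw [h6, le_div_iff₀ (by positivity)]
  linarith

set_option maxHeartbeats 2000000 in
/-- Adaptivity and robustness of clustered ARMUL with cardinality constraints
(deterministic version, with outlier tasks). -/
theorem stmt_8 (d m K : ℕ) (hd : 1 ≤ d) (hm : 1 ≤ m) (hK : 2 ≤ K)
    (α : ℝ) (hα0 : 0 < α) (hα1 : α ≤ 1)
    (f : Fin m → EuclideanSpace ℝ (Fin d) → ℝ)
    (hconv : ∀ j, ConvexOn ℝ Set.univ (f j)) (hdiff : ∀ j, Differentiable ℝ (f j))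
    (θs : Fin m → EuclideanSpace ℝ (Fin d)) (βs : Fin K → EuclideanSpace ℝ (Fin d))
    (zs : Fin m → Fin K) (M ρ L ε δ lam κ : ℝ) (S : Finset (Fin m))
    (hM : 0 < M) (hρ : 0 < ρ) (hρL : ρ ≤ L) (hε : 0 ≤ ε) (hδ : 0 ≤ δ)
    (hSc : ((Sᶜ : Finset (Fin m)).card : ℝ) ≤ ε * m)
    (hreg : ∀ j ∈ S, ARMULRegular (f j) (θs j) M ρ L)
    (hclose : ∀ j ∈ S, ‖θs j - βs (zs j)‖ ≤ δ)
    (hκ : κ = L / ρ)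
    (hεα : ε ≤ α / (6 * κ * K ^ 2))
    (hbal : ∀ k : Fin K,
      7 * α * m / (6 * K) ≤ ((Finset.univ.filter fun j => zs j = k).card : ℝ))
    (hlam1 : ∀ j, 12 * κ * K / Real.sqrt α * ‖gradient (f j) (θs j)‖ < lam)
    (hlam2 : lam < ρ / 6 * M)
    (hlam3 : ∀ k l : Fin K, k ≠ l → lam < ρ / 6 * ‖βs k - βs l‖)
    (θhat : Fin m → EuclideanSpace ℝ (Fin d)) (βhat : Fin K → EuclideanSpace ℝ (Fin d))
    (zhat : Fin m → Fin K)
    (hcard : ∀ k : Fin K,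
      α * m / K ≤ ((Finset.univ.filter fun j => zhat j = k).card : ℝ))
    (hmin : ∀ (θ : Fin m → EuclideanSpace ℝ (Fin d))
        (β : Fin K → EuclideanSpace ℝ (Fin d)) (z : Fin m → Fin K),
      (∀ k : Fin K, α * m / K ≤ ((Finset.univ.filter fun j => z j = k).card : ℝ)) →
      ∑ j, (f j (θhat j) + lam * ‖βhat (zhat j) - θhat j‖) ≤
      ∑ j, (f j (θ j) + lam * ‖β (z j) - θ j‖)) :
    (∀ j ∈ S, ‖θhat j - θs j‖ ≤
      ‖∑ i ∈ (Finset.univ.filter fun i => zs i = zs j) ∩ S, gradient (f i) (θs i)‖ /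
        (ρ * (((Finset.univ.filter fun i => zs i = zs j) ∩ S).card : ℝ)) +
      min (55 * κ ^ 2 * K * δ / Real.sqrt α) (11 * lam / (5 * ρ)) +
      lam * ((Sᶜ : Finset (Fin m)).card : ℝ) /
        (ρ * (((Finset.univ.filter fun i => zs i = zs j) ∩ S).card : ℝ))) ∧
    (δ ≤ Real.sqrt α * lam / (100 * κ * K * L) →
      ∃ τ : Equiv.Perm (Fin K),
        ∀ j ∈ S, zhat j = τ (zs j) ∧ θhat j = βhat (zhat j)) := by
  have hL0 : 0 < L := by linarith
  have hκ1 : 1 ≤ κ := by rw [hκ, le_div_iff₀ hρ]; linarith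
  have hκ0 : 0 < κ := by linarith
  have hLκ : L = κ * ρ := by rw [hκ]; field_simp
  have hK2 : (2:ℝ) ≤ K := by exact_mod_cast hK
  have hK0 : (0:ℝ) < K := by linarith
  have hm0 : (0:ℝ) < m := by exact_mod_cast hm
  obtain ⟨q, hq⟩ : ∃ q, q = Real.sqrt α := ⟨_, rfl⟩
  have hq0 : 0 < q := by rw [hq]; exact Real.sqrt_pos.mpr hα0
  have hq1 : q ≤ 1 := by rw [hq]; exact Real.sqrt_le_one.mpr hα1
  have hq2 : α = q ^ 2 := by rw [hq, Real.sq_sqrt hα0.le]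
  rw [← hq] at hlam1
  rw [← hq]
  have hlam : 0 < lam := by
    have h1 := hlam1 ⟨0, hm⟩
    refine lt_of_le_of_lt ?_ h1
    positivity
  obtain ⟨N, hN⟩ : ∃ N, N = α * m / K := ⟨_, rfl⟩
  have hN0 : 0 < N := by rw [hN]; positivity
  obtain ⟨G, hG⟩ : ∃ G, G = q * lam / (12 * κ * K) := ⟨_, rfl⟩
  have hG0 : 0 ≤ G := by rw [hG]; positivity
  have hgrad : ∀ j, ‖gradient (f j) (θs j)‖ ≤ G := by
    intro j
    have h1 := (hlam1 j).le
    rw [hG, le_div_iff₀ (by positivity)]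
    have h2 : 12 * κ * K / q * ‖gradient (f j) (θs j)‖ =
      ‖gradient (f j) (θs j)‖ * (12 * κ * K) / q := by ring
    rw [h2, div_le_iff₀ hq0] at h1
    linarith
  have hκK : 2 * κ ≤ κ * K := by nlinarith
  have hG24 : G ≤ lam / (24 * κ) := by
    rw [hG]
    apply div_le_div₀ hlam.le
    · nlinarith
    · positivity
    · nlinarith
  have hG24' : G ≤ lam / 24 :=
    hG24.trans (div_le_div_of_nonneg_left hlam.le (by norm_num) (by linarith))
  have hGM : G + lam < ρ / 2 * M := by linarith
  have hScN : ((Sᶜ : Finset (Fin m)).card : ℝ) ≤ N / (12 * κ) := by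
    have h1 : ε * m ≤ α / (6 * κ * K ^ 2) * m := mul_le_mul_of_nonneg_right hεα hm0.le
    have h2 : α / (6 * κ * K ^ 2) * m = N / (6 * κ * K) := by
      rw [hN]; field_simp
    have h3 : N / (6 * κ * K) ≤ N / (12 * κ) :=
      div_le_div_of_nonneg_left hN0.le (by positivity) (by linarith)
    linarith
  have hbal' : ∀ k : Fin K, N ≤ (((Finset.univ.filter fun j => zs j = k) ∩ S).card : ℝ) := by
    intro k
    have h1 := hbal k
    have h0 : 7 * α * m / (6 * K) = 7 / 6 * N := by rw [hN]; field_simp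
    have h2 : (Finset.univ.filter fun j => zs j = k).card ≤
        ((Finset.univ.filter fun j => zs j = k) ∩ S).card + (Sᶜ).card := by
      rw [← Finset.card_inter_add_card_sdiff _ S]
      gcongr
      intro j hj
      simp only [Finset.mem_sdiff] at hj
      simpa using hj.2
    have h3 : ((Finset.univ.filter fun j => zs j = k).card : ℝ) ≤
        (((Finset.univ.filter fun j => zs j = k) ∩ S).card : ℝ)
          + ((Sᶜ : Finset (Fin m)).card : ℝ) := by exact_mod_cast h2
    have h4 : N / (12 * κ) ≤ N / 12 := by
      apply div_le_div_of_nonneg_left hN0.le (by norm_num); linarith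
    linarith
  have hlM : 6 * (lam / ρ) < M := by
    have : 6 * (lam / ρ) = 6 * lam / ρ := by ring
    rw [this, div_lt_iff₀ hρ]; linarith
  have hl3 : ∀ k l : Fin K, k ≠ l → 6 * (lam / ρ) < ‖βs k - βs l‖ := by
    intro k l hkl
    have : 6 * (lam / ρ) = 6 * lam / ρ := by ring
    rw [this, div_lt_iff₀ hρ]; linarith [hlam3 k l hkl]
  have hcard' : ∀ k : Fin K, N ≤ ((Finset.univ.filter fun j => zhat j = k).card : ℝ) := by
    rw [hN]; exact hcard
  rw [← hN] at hmin
  -- clustering for small δ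
  have hclus : δ ≤ q * lam / (25 * κ * K * L) →
      ∃ τ : Equiv.Perm (Fin K), ∀ j ∈ S, zhat j = τ (zs j) ∧ θhat j = βhat (zhat j) ∧
        ‖βhat (zhat j) - θs j‖ ≤ lam / (2 * L) := by
    intro hδ0
    have hδ2 : δ ≤ lam / (50 * L) := by
      refine hδ0.trans ?_
      apply div_le_div₀ hlam.le
      · nlinarith
      · positivity
      · have : 2 ≤ κ * K := by linarith
        nlinarith
    refine cluster (by omega) hM hρ hκ1 hLκ hδ hlam hN0 hG0 hG24 hδ2 ?_ hScN hreg
      (fun j _ => hgrad j) hclose hbal' hlM hl3 hcard' hmin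
    obtain ⟨X, hX⟩ : ∃ X, X = α * lam ^ 2 / (κ ^ 2 * K ^ 2 * ρ) := ⟨_, rfl⟩
    have hX0 : 0 < X := by rw [hX]; positivity
    have hXL : α * lam ^ 2 / (κ ^ 2 * K ^ 2 * L) ≤ X := by
      rw [hX]; gcongr
    have e1 : G ^ 2 / (2 * ρ) = X / 288 := by
      rw [hG, hX, hq2]; field_simp; norm_num
    have e2 : G * δ ≤ X / 300 := by
      have h1 : G * δ ≤ G * (q * lam / (25 * κ * K * L)) := by gcongr
      have h2 : G * (q * lam / (25 * κ * K * L)) =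
          α * lam ^ 2 / (κ ^ 2 * K ^ 2 * L) / 300 := by
        rw [hG, hq2]; field_simp; norm_num
      linarith
    have e3 : L / 2 * δ ^ 2 ≤ X / 1250 := by
      have h1 : L / 2 * δ ^ 2 ≤ L / 2 * (q * lam / (25 * κ * K * L)) ^ 2 := by gcongr
      have h2 : L / 2 * (q * lam / (25 * κ * K * L)) ^ 2 =
          α * lam ^ 2 / (κ ^ 2 * K ^ 2 * L) / 1250 := by
        rw [hq2]; field_simp; norm_num
      linarith
    have e4 : G ^ 2 / (2 * ρ) + G * δ + L / 2 * δ ^ 2 ≤ X / 125 := by linarith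
    have e5 : m * (X / 125) = N * lam ^ 2 / (125 * K * κ ^ 2 * ρ) := by
      rw [hX, hN]; field_simp
    have e6 : N * lam ^ 2 / (125 * K * κ ^ 2 * ρ) ≤ N * lam ^ 2 / (250 * κ ^ 2 * ρ) := by
      apply div_le_div_of_nonneg_left (by positivity) (by positivity)
      have : 250 ≤ 125 * (K:ℝ) := by linarith
      gcongr
    have e7 := mul_le_mul_of_nonneg_left e4 hm0.le
    linarith
  have hcrude : ∀ j ∈ S, ‖θhat j - θs j‖ ≤ 11 * lam / (5 * ρ) := by
    intro j hj
    have hopt : f j (θhat j) ≤ f j (θs j) + lam * ‖θhat j - θs j‖ := by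
      have h1 := hmin (Function.update θhat j (θs j)) βhat zhat hcard'
      rw [← Finset.add_sum_erase _ _ (Finset.mem_univ j),
        ← Finset.add_sum_erase (Finset.univ) (fun i => f i (Function.update θhat j (θs j) i) +
          lam * ‖βhat (zhat i) - Function.update θhat j (θs j) i‖) (Finset.mem_univ j)] at h1
      have h2 : ∑ i ∈ Finset.univ.erase j, (f i (Function.update θhat j (θs j) i) +
          lam * ‖βhat (zhat i) - Function.update θhat j (θs j) i‖) =
          ∑ i ∈ Finset.univ.erase j, (f i (θhat i) + lam * ‖βhat (zhat i) - θhat i‖) := by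
        apply Finset.sum_congr rfl
        intro i hi
        rw [Function.update_of_ne (Finset.ne_of_mem_erase hi)]
      rw [h2] at h1
      simp only [Function.update_self] at h1
      have t := norm_sub_le_norm_sub_add_norm_sub (βhat (zhat j)) (θhat j) (θs j)
      have t2 := mul_le_mul_of_nonneg_left t hlam.le
      linarith
    have h1 := crude hM hρ (hreg j hj) (hgrad j) hGM (θhat j) hopt hlam.le
    refine h1.trans ?_
    rw [div_le_div_iff₀ hρ (by positivity)]
    nlinarith
  refine ⟨?_, ?_⟩
  · intro j hj
    set A := (Finset.univ.filter fun i => zs i = zs j) ∩ S with hA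
    have hAc : 0 < (A.card : ℝ) := lt_of_lt_of_le hN0 (hbal' (zs j))
    have p1 : 0 ≤ ‖∑ i ∈ A, gradient (f i) (θs i)‖ / (ρ * (A.card : ℝ)) :=
      div_nonneg (norm_nonneg _) (mul_pos hρ hAc).le
    have p2 : 0 ≤ lam * ((Sᶜ : Finset (Fin m)).card : ℝ) / (ρ * (A.card : ℝ)) :=
      div_nonneg (mul_nonneg hlam.le (Nat.cast_nonneg _)) (mul_pos hρ hAc).le
    have c1 := hcrude j hj
    by_cases hδ0 : δ ≤ q * lam / (25 * κ * K * L)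
    · obtain ⟨τ, hτ⟩ := hclus hδ0
      have hmem : ∀ i, i ∈ A ↔ zs i = zs j ∧ i ∈ S := by
        intro i; simp [hA]
      have hwM : lam / (2 * L) ≤ M := by
        have : lam / (2 * L) ≤ lam / ρ :=
          div_le_div_of_nonneg_left hlam.le hρ (by linarith)
        have : 0 < lam / ρ := by positivity
        linarith
      have hδM : 2 * δ ≤ M := by
        have h1 : q * lam / (25 * κ * K * L) ≤ lam / ρ := by
          apply div_le_div₀ hlam.le
          · nlinarith
          · exact hρ
          · have : 1 ≤ 25 * κ * K := by nlinarith
            nlinarith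
        have : 0 < lam / ρ := by positivity
        linarith
      have hbi : ∀ i ∈ A, βhat (zhat i) = βhat (zhat j) := by
        intro i hi
        have hi := (hmem i).mp hi
        rw [(hτ i hi.2).1, (hτ j hj).1, hi.1]
      have hpδ : ∀ i ∈ A, ‖θs j - θs i‖ ≤ 2 * δ := by
        intro i hi
        have hi := (hmem i).mp hi
        have h1 := hclose i hi.2
        have h2 := hclose j hj
        rw [hi.1, norm_sub_rev] at h1
        have t := norm_sub_le_norm_sub_add_norm_sub (θs j) (βs (zs j)) (θs i)
        linarith
      have hopt : ∀ b', ∑ i ∈ A, f i (βhat (zhat j)) ≤ ∑ i ∈ A, f i b' +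
          lam * ((Sᶜ : Finset (Fin m)).card : ℝ) * ‖b' - βhat (zhat j)‖ := by
        intro b'
        have h1 := hmin (fun i => if i ∈ A then b' else θhat i)
          (Function.update βhat (zhat j) b') zhat hcard'
        have h2 := split_cmp S _ _ (lam * ‖b' - βhat (zhat j)‖) h1 (by
          intro i hi
          have hiA : i ∉ A := fun h => hi ((hmem i).mp h).2
          simp only [if_neg hiA]
          by_cases hz : zhat i = zhat j
          · rw [hz, Function.update_self]
            have t := norm_sub_le_norm_sub_add_norm_sub b' (βhat (zhat j)) (θhat i)
            have t2 := mul_le_mul_of_nonneg_left t hlam.le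
            linarith
          · rw [Function.update_of_ne hz]
            have : 0 ≤ lam * ‖b' - βhat (zhat j)‖ := by positivity
            linarith)
        have hAS : A ⊆ S := Finset.inter_subset_right
        rw [← Finset.sum_sdiff hAS, ← Finset.sum_sdiff hAS] at h2
        have h3 : ∑ i ∈ S \ A, (f i (if i ∈ A then b' else θhat i) +
            lam * ‖Function.update βhat (zhat j) b' (zhat i) - (if i ∈ A then b' else θhat i)‖) =
            ∑ i ∈ S \ A, (f i (θhat i) + lam * ‖βhat (zhat i) - θhat i‖) := by
          apply Finset.sum_congr rfl
          intro i hi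
          rw [Finset.mem_sdiff] at hi
          rw [if_neg hi.2, Function.update_of_ne]
          intro hz
          apply hi.2
          rw [hmem]
          refine ⟨?_, hi.1⟩
          rw [(hτ i hi.1).1, (hτ j hj).1] at hz
          exact τ.injective hz
        have h4 : ∑ i ∈ A, (f i (if i ∈ A then b' else θhat i) +
            lam * ‖Function.update βhat (zhat j) b' (zhat i) - (if i ∈ A then b' else θhat i)‖) =
            ∑ i ∈ A, f i b' := by
          apply Finset.sum_congr rfl
          intro i hi
          have hi' := (hmem i).mp hi
          have hz : zhat i = zhat j := by
            rw [(hτ i hi'.2).1, (hτ j hj).1, hi'.1]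
          rw [if_pos hi, hz, Function.update_self]
          simp
        have h5 : ∑ i ∈ A, (f i (θhat i) + lam * ‖βhat (zhat i) - θhat i‖) =
            ∑ i ∈ A, f i (βhat (zhat j)) := by
          apply Finset.sum_congr rfl
          intro i hi
          have hi' := (hmem i).mp hi
          rw [(hτ i hi'.2).2.1, hbi i hi]
          simp
        rw [h3, h4, h5] at h2
        linarith
      have c2 := refine_bound (L := L) (δ := δ) A hAc hρ hL0
        (fun i hi => hreg i ((hmem i).mp hi).2) (βhat (zhat j)) (θs j)
        (fun i hi => by
          have := (hτ i ((hmem i).mp hi).2).2.2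
          rw [hbi i hi] at this
          linarith)
        (fun i hi => (hpδ i hi).trans hδM) hpδ hopt
        (mul_nonneg hlam.le (Nat.cast_nonneg _)) hδ
      rw [← (hτ j hj).2.1, ← hκ] at c2
      have c3 : 2 * κ * δ ≤ 55 * κ ^ 2 * K * δ / q := by
        rw [le_div_iff₀ hq0]
        have h1 : 2 * κ * δ * q ≤ 2 * κ * δ := by
          apply mul_le_of_le_one_right (by positivity) hq1
        have h2 : 2 * κ * δ ≤ 55 * κ ^ 2 * K * δ := by
          have : 2 * κ ≤ 55 * κ ^ 2 * K := by nlinarith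
          exact mul_le_mul_of_nonneg_right this hδ
        linarith
      rcases min_choice (55 * κ ^ 2 * K * δ / q) (11 * lam / (5 * ρ)) with h | h
      · rw [h]; linarith
      · rw [h]; linarith
    · push Not at hδ0
      rw [min_eq_right]
      · linarith
      · rw [div_lt_iff₀ (by positivity)] at hδ0
        rw [div_le_div_iff₀ (by positivity) hq0]
        rw [hLκ] at hδ0
        have h1 : δ * (25 * κ * K * (κ * ρ)) * 11 = 55 * κ ^ 2 * K * δ * (5 * ρ) := by ring
        linarith
  · intro hδ0
    have h1 : q * lam / (100 * κ * K * L) ≤ q * lam / (25 * κ * K * L) := by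
      apply div_le_div_of_nonneg_left (by positivity) (by positivity)
      have : 0 < κ * K * L := by positivity
      nlinarith
    obtain ⟨τ, hτ⟩ := hclus (hδ0.trans h1)
    exact ⟨τ, fun j hj => ⟨(hτ j hj).1, (hτ j hj).2.1⟩⟩
end
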